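/- arXiv:math/0506288 — 2 statements merged into one kernel-verified Lean document; each statement's English description precedes it below -/
import Mathlib

section
/- For every ε > 0 there exist L and K such that the following holds. Let T and T' be colored trees which are not isomorphic as colored trees, with v(T) ≥ v(T'), n = v(T), and maximum degree Δ(T) ≤ l. If l ≥ L and ln n / ln l ≥ K, then there is a first-order sentence, all of whose quantifiers are existential, of quantifier depth at most (1 + ε) · l · ln n / ln l, which is true in T and false in T'. -/
namespace FODef

/-- A graph colored with `K` unary predicates. -/
structure CGraph (K : ℕ) (V : Type) where
  graph : SimpleGraph V
  color : Fin K → V → Prop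

/-- First-order formulas in the language of graphs with `K` unary color predicates,
with free variables among `x_0, …, x_{n-1}`. -/
inductive CForm (K : ℕ) : ℕ → Type
  | adj {n : ℕ} (i j : Fin n) : CForm K n
  | eq {n : ℕ} (i j : Fin n) : CForm K n
  | col {n : ℕ} (c : Fin K) (i : Fin n) : CForm K n
  | neg {n : ℕ} : CForm K n → CForm K n
  | conj {n : ℕ} : CForm K n → CForm K n → CForm K n
  | disj {n : ℕ} : CForm K n → CForm K n → CForm K n
  | ex {n : ℕ} : CForm K (n + 1) → CForm K n
  | fa {n : ℕ} : CForm K (n + 1) → CForm K n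

/-- Realization of a formula in a colored graph, under a valuation of the free variables. -/
def CForm.Realize {K : ℕ} {V : Type} (C : CGraph K V) :
    ∀ {n : ℕ}, CForm K n → (Fin n → V) → Prop
  | _, .adj i j, f => C.graph.Adj (f i) (f j)
  | _, .eq i j, f => f i = f j
  | _, .col c i, f => C.color c (f i)
  | _, .neg φ, f => ¬ CForm.Realize C φ f
  | _, .conj φ ψ, f => CForm.Realize C φ f ∧ CForm.Realize C ψ f
  | _, .disj φ ψ, f => CForm.Realize C φ f ∨ CForm.Realize C ψ f
  | _, .ex φ, f => ∃ v : V, CForm.Realize C φ (Fin.snoc f v)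
  | _, .fa φ, f => ∀ v : V, CForm.Realize C φ (Fin.snoc f v)

/-- Quantifier depth: the maximum number of nested quantifiers. -/
def CForm.depth {K : ℕ} : ∀ {n : ℕ}, CForm K n → ℕ
  | _, .adj _ _ => 0
  | _, .eq _ _ => 0
  | _, .col _ _ => 0
  | _, .neg φ => φ.depth
  | _, .conj φ ψ => max φ.depth ψ.depth
  | _, .disj φ ψ => max φ.depth ψ.depth
  | _, .ex φ => φ.depth + 1
  | _, .fa φ => φ.depth + 1

/-- Isomorphism of colored graphs: a graph isomorphism preserving all colors. -/
def CIso {K : ℕ} {V W : Type} (C : CGraph K V) (C' : CGraph K W) : Prop :=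
  ∃ e : V ≃ W, (∀ v w : V, C.graph.Adj v w ↔ C'.graph.Adj (e v) (e w)) ∧
    ∀ (c : Fin K) (v : V), C.color c v ↔ C'.color c (e v)

/-- A sentence (formula with no free variables) holds in a colored graph. -/
def CSat {K : ℕ} {V : Type} (C : CGraph K V) (φ : CForm K 0) : Prop :=
  φ.Realize C ![]

/-- A sentence defines a colored graph `C` if `C` satisfies it and every finite colored
graph (in the same language) satisfying it is isomorphic to `C`. -/
def CDefines {K : ℕ} {V : Type} (C : CGraph K V) (φ : CForm K 0) : Prop :=
  CSat C φ ∧ ∀ (m : ℕ) (C' : CGraph K (Fin m)), CSat C' φ → CIso C C'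

/-- Minimum quantifier depth of a first-order sentence defining a colored graph. -/
noncomputable def Dcol {K : ℕ} {V : Type} (C : CGraph K V) : ℕ :=
  sInf {d | ∃ φ : CForm K 0, φ.depth = d ∧ CDefines C φ}

/-- A colored tree: the underlying graph is connected and acyclic. -/
def IsColTree {K : ℕ} {V : Type} (C : CGraph K V) : Prop :=
  C.graph.Connected ∧ C.graph.IsAcyclic

/-- Degree of a vertex. -/
noncomputable def deg {V : Type} (G : SimpleGraph V) (v : V) : ℕ :=
  Nat.card {w // G.Adj v w}

/-- `Dtree n l`: the maximum of `Dcol T` over all colored trees `T` with at most `n`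
vertices and maximum degree at most `l` (with any finite number of colors). -/
noncomputable def Dtree (n l : ℕ) : ℕ :=
  sSup {d | ∃ (K m : ℕ) (C : CGraph K (Fin m)), IsColTree C ∧ m ≤ n ∧
    (∀ v, deg C.graph v ≤ l) ∧ d = Dcol C}

/-- An uncolored graph, viewed as a colored graph with no colors.  A sentence of the
pure graph language defines it iff it `CDefines` it, and `CIso` for such graphs is plain
graph isomorphism, so `Dcol (plain G)` is the minimum quantifier depth `D(G)` of a
first-order sentence defining the (uncolored) graph `G`. -/
def plain {V : Type} (G : SimpleGraph V) : CGraph 0 V :=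
  ⟨G, fun c _ => c.elim0⟩

end FODef

namespace FODef

/-- Quantifier-free formulas. -/
def CForm.qfree {K : ℕ} : ∀ {n : ℕ}, CForm K n → Prop
  | _, .adj _ _ => True
  | _, .eq _ _ => True
  | _, .col _ _ => True
  | _, .neg φ => φ.qfree
  | _, .conj φ ψ => φ.qfree ∧ ψ.qfree
  | _, .disj φ ψ => φ.qfree ∧ ψ.qfree
  | _, .ex _ => False
  | _, .fa _ => False

/-- Formulas all of whose quantifiers are existential (and no quantifier occurs
within the scope of a negation sign). -/
def CForm.exOnly {K : ℕ} : ∀ {n : ℕ}, CForm K n → Prop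
  | _, .adj _ _ => True
  | _, .eq _ _ => True
  | _, .col _ _ => True
  | _, .neg φ => φ.qfree
  | _, .conj φ ψ => φ.exOnly ∧ ψ.exOnly
  | _, .disj φ ψ => φ.exOnly ∧ ψ.exOnly
  | _, .ex φ => φ.exOnly
  | _, .fa _ => False

end FODef

open Filter FODef

namespace FODef

/-- A set of pairs of pebbled vertices that is not a partial isomorphism. -/
def Clash {K : ℕ} {V V' : Type} (T : CGraph K V) (T' : CGraph K V') (S : Set (V × V')) : Prop :=
  ∃ p ∈ S, ∃ q ∈ S, ¬ (T.graph.Adj p.1 q.1 ↔ T'.graph.Adj p.2 q.2) ∨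
    ¬ (p.1 = q.1 ↔ p.2 = q.2) ∨ ∃ c, ¬ (T.color c p.1 ↔ T'.color c p.2)

/-- Spoiler wins the Ehrenfeucht game from position `S` in `d` rounds, playing only in `T`. -/
def SpoilerWins {K : ℕ} {V V' : Type} (T : CGraph K V) (T' : CGraph K V') :
    ℕ → Set (V × V') → Prop
  | 0, S => Clash T T' S
  | d + 1, S => Clash T T' S ∨ ∃ v, ∀ v', SpoilerWins T T' d (insert (v, v') S)

section Game

variable {K : ℕ} {V V' : Type} {T : CGraph K V} {T' : CGraph K V'}

lemma Clash.spoilerWins {S : Set (V × V')} (h : Clash T T' S) :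
    ∀ d, SpoilerWins T T' d S
  | 0 => h
  | _ + 1 => Or.inl h

lemma SpoilerWins.mono {d e : ℕ} {S : Set (V × V')} (h : SpoilerWins T T' d S) (hde : d ≤ e) :
    SpoilerWins T T' e S := by
  induction d generalizing e S with
  | zero => exact Clash.spoilerWins h e
  | succ d ih =>
    obtain ⟨e, rfl⟩ : ∃ e', e = e' + 1 := ⟨e - 1, by omega⟩
    rcases h with h | ⟨v, hv⟩
    · exact Or.inl h
    · exact Or.inr ⟨v, fun v' => ih (hv v') (by omega)⟩

lemma exists_common_formula {d m : ℕ} {f : Fin m → V} {f' : V' → Fin m → V'} (hm : 0 < m)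
    (h : ∀ v', ∃ φ : CForm K m, φ.exOnly ∧ φ.depth ≤ d ∧ φ.Realize T f ∧ ¬ φ.Realize T' (f' v'))
    (s : Finset V') :
    ∃ φ : CForm K m, φ.exOnly ∧ φ.depth ≤ d ∧ φ.Realize T f ∧
      ∀ v' ∈ s, ¬ φ.Realize T' (f' v') := by
  classical
  induction s using Finset.induction with
  | empty => exact ⟨.eq ⟨0, hm⟩ ⟨0, hm⟩, trivial, Nat.zero_le _, rfl, by simp⟩
  | insert a s _ ih =>
    obtain ⟨φ, h1, h2, h3, h4⟩ := ih
    obtain ⟨ψ, k1, k2, k3, k4⟩ := h a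
    refine ⟨.conj ψ φ, ⟨k1, h1⟩, max_le k2 h2, ⟨k3, h3⟩, fun v' hv' hr => ?_⟩
    rcases Finset.mem_insert.1 hv' with rfl | hv'
    · exact k4 hr.1
    · exact h4 v' hv' hr.2

lemma Clash.exists_formula {m : ℕ} {f : Fin m → V} {f' : Fin m → V'}
    (h : Clash T T' (Set.range fun i => (f i, f' i))) :
    ∃ φ : CForm K m, φ.exOnly ∧ φ.depth = 0 ∧ φ.Realize T f ∧ ¬ φ.Realize T' f' := by
  obtain ⟨_, ⟨i, rfl⟩, _, ⟨j, rfl⟩, h⟩ := h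
  have key : ∀ φ : CForm K m, φ.qfree → φ.exOnly → φ.depth = 0 →
      ¬ (φ.Realize T f ↔ φ.Realize T' f') →
      ∃ φ : CForm K m, φ.exOnly ∧ φ.depth = 0 ∧ φ.Realize T f ∧ ¬ φ.Realize T' f' := by
    intro φ h1 h2 h3 h4
    by_cases hφ : φ.Realize T f
    · exact ⟨φ, h2, h3, hφ, by tauto⟩
    · exact ⟨.neg φ, h1, h3, hφ, fun hn => hn (by tauto)⟩
  rcases h with h | h | ⟨c, h⟩
  · exact key (.adj i j) trivial trivial rfl h
  · exact key (.eq i j) trivial trivial rfl h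
  · exact key (.col c i) trivial trivial rfl h

lemma SpoilerWins.exists_formula [Fintype V'] {d m : ℕ} {f : Fin m → V} {f' : Fin m → V'}
    (h : SpoilerWins T T' d (Set.range fun i => (f i, f' i))) :
    ∃ φ : CForm K m, φ.exOnly ∧ φ.depth ≤ d ∧ φ.Realize T f ∧ ¬ φ.Realize T' f' := by
  induction d generalizing m with
  | zero =>
    obtain ⟨φ, h1, h2, h3⟩ := Clash.exists_formula h
    exact ⟨φ, h1, h2.le, h3⟩
  | succ d ih =>
    rcases h with h | ⟨v, hv⟩
    · obtain ⟨φ, h1, h2, h3⟩ := Clash.exists_formula h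
      exact ⟨φ, h1, by omega, h3⟩
    · obtain ⟨φ, h1, h2, h3, h4⟩ := exists_common_formula (T := T) (T' := T') (d := d)
        (f := Fin.snoc f v) (f' := fun v' => Fin.snoc f' v') (Nat.succ_pos m) (fun v' => ih (by
          convert hv v' using 1
          ext p
          simp only [Set.mem_range, Set.mem_insert_iff]
          constructor
          · rintro ⟨i, rfl⟩
            induction i using Fin.lastCases with
            | last => simp
            | cast i => exact Or.inr ⟨i, by simp⟩
          · rintro (rfl | ⟨i, rfl⟩)
            · exact ⟨Fin.last m, by simp⟩
            · exact ⟨i.castSucc, by simp⟩)) Finset.univ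
      exact ⟨.ex φ, h1, Nat.succ_le_succ h2, ⟨v, h3⟩, fun ⟨v', hv'⟩ => h4 v' (Finset.mem_univ _) hv'⟩

end Game

section Branch

variable {V : Type} {G : SimpleGraph V}

/-- The vertices reachable from `w` by a walk avoiding `z`. -/
def branch (G : SimpleGraph V) (z w : V) : Set V :=
  {x | ∃ p : G.Walk w x, z ∉ p.support}

/-- Any two vertices of `C` are joined by a walk inside `C`. -/
def WalkConnected (G : SimpleGraph V) (C : Set V) : Prop :=
  ∀ x ∈ C, ∀ y ∈ C, ∃ p : G.Walk x y, ∀ u ∈ p.support, u ∈ C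

lemma self_mem_branch {z w : V} (h : w ≠ z) : w ∈ branch G z w :=
  ⟨.nil, by simpa using h.symm⟩

lemma notMem_branch (z w : V) : z ∉ branch G z w :=
  fun ⟨p, hp⟩ => hp p.end_mem_support

lemma branch_unique (hG : G.IsAcyclic) {z w w' x : V} (hw : G.Adj z w) (hw' : G.Adj z w')
    (hx : x ∈ branch G z w) (hx' : x ∈ branch G z w') : w = w' := by
  classical
  obtain ⟨p, hp⟩ := hx
  obtain ⟨q, hq⟩ := hx'
  have hp' : z ∉ p.bypass.support := fun h => hp (p.support_bypass_subset_support h)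
  have hq' : z ∉ q.bypass.support := fun h => hq (q.support_bypass_subset_support h)
  have h1 : (p.bypass.cons hw).IsPath := p.bypass_isPath.cons hp'
  have h2 : (q.bypass.cons hw').IsPath := q.bypass_isPath.cons hq'
  have := congrArg Subtype.val ((hG.subsingleton_path _ _).elim ⟨_, h1⟩ ⟨_, h2⟩)
  simp only [SimpleGraph.Walk.cons.injEq] at this
  exact this.1

lemma mem_branch_of_adj {z w x y : V} (hx : x ∈ branch G z w) (hxy : G.Adj x y) (hy : y ≠ z) :
    y ∈ branch G z w := by
  obtain ⟨p, hp⟩ := hx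
  refine ⟨p.concat hxy, ?_⟩
  rw [SimpleGraph.Walk.support_concat]
  simp [hp, hy.symm]

lemma eq_of_adj_of_mem_branch (hG : G.IsAcyclic) {z w x : V} (hw : G.Adj z w)
    (hx : x ∈ branch G z w) (hzx : G.Adj z x) : x = w :=
  branch_unique hG hzx hw (self_mem_branch hzx.ne') hx

lemma disjoint_branch_swap (hG : G.IsAcyclic) {z w x : V} (hw : G.Adj z w)
    (hx : x ∈ branch G z w) : x ∉ branch G w z := by
  classical
  rintro ⟨q, hq⟩
  obtain ⟨p, hp⟩ := hx
  have hp' : z ∉ p.bypass.support := fun h => hp (p.support_bypass_subset_support h)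
  have hq' : w ∉ q.bypass.support := fun h => hq (q.support_bypass_subset_support h)
  have h1 : (p.bypass.cons hw).IsPath := p.bypass_isPath.cons hp'
  have := congrArg Subtype.val ((hG.subsingleton_path _ _).elim ⟨_, h1⟩ ⟨_, q.bypass_isPath⟩)
  simp only at this
  rw [← this] at hq'
  simp at hq'

lemma branch_subset_branch (hG : G.IsAcyclic) {z w y : V} (hw : G.Adj z w) (hy : G.Adj w y)
    (hyz : y ≠ z) : branch G w y ⊆ branch G z w := by
  classical
  rintro x ⟨p, hp⟩
  refine ⟨p.cons hy, ?_⟩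
  simp only [SimpleGraph.Walk.support_cons, List.mem_cons, not_or]
  refine ⟨hw.ne, fun hz => hyz ?_⟩
  have : z ∈ branch G w y :=
    ⟨p.takeUntil z hz, fun h => hp (p.support_takeUntil_subset_support hz h)⟩
  exact (eq_of_adj_of_mem_branch hG hy this hw.symm).symm

/-- In a connected set containing `z`, each other vertex is reached inside the set from a
neighbor of `z` by a walk avoiding `z`. -/
lemma WalkConnected.exists_adj {C : Set V} (hC : WalkConnected G C) {z x : V} (hz : z ∈ C)
    (hx : x ∈ C) (hxz : x ≠ z) :
    ∃ w ∈ C, G.Adj z w ∧ ∃ p : G.Walk w x, z ∉ p.support ∧ ∀ u ∈ p.support, u ∈ C := by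
  classical
  obtain ⟨p, hp⟩ := hC z hz x hx
  have hp' : ∀ u ∈ p.bypass.support, u ∈ C :=
    fun u hu => hp u (p.support_bypass_subset_support hu)
  have hpath := p.bypass_isPath
  generalize p.bypass = q at hp' hpath
  cases q with
  | nil => exact absurd rfl hxz
  | cons h q =>
    rw [SimpleGraph.Walk.cons_isPath_iff] at hpath
    simp only [SimpleGraph.Walk.support_cons, List.mem_cons, forall_eq_or_imp] at hp'
    exact ⟨_, hp'.2 _ q.start_mem_support, h, q, hpath.2, hp'.2⟩

lemma WalkConnected.exists_mem_branch {C : Set V} (hC : WalkConnected G C) {z x : V} (hz : z ∈ C)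
    (hx : x ∈ C) (hxz : x ≠ z) : ∃ w ∈ C, G.Adj z w ∧ x ∈ branch G z w :=
  let ⟨w, h1, h2, p, h3, _⟩ := hC.exists_adj hz hx hxz
  ⟨w, h1, h2, p, h3⟩

lemma WalkConnected.inter_branch (hG : G.IsAcyclic) {C : Set V} (hC : WalkConnected G C) {z w : V}
    (hz : z ∈ C) (hw : G.Adj z w) : WalkConnected G (C ∩ branch G z w) := by
  classical
  have key : ∀ x ∈ C ∩ branch G z w, ∃ p : G.Walk w x, ∀ u ∈ p.support, u ∈ C ∩ branch G z w := by
    rintro x ⟨hx, hxb⟩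
    obtain ⟨w', hw'C, hw', p, hp, hpC⟩ := hC.exists_adj hz hx
      (fun h => notMem_branch (G := G) z w (h ▸ hxb))
    obtain rfl := branch_unique hG hw hw' hxb ⟨p, hp⟩
    exact ⟨p, fun u hu => ⟨hpC u hu, p.takeUntil u hu,
      fun h => hp (p.support_takeUntil_subset_support hu h)⟩⟩
  intro x hx y hy
  obtain ⟨p, hp⟩ := key x hx
  obtain ⟨q, hq⟩ := key y hy
  refine ⟨p.reverse.append q, fun u hu => ?_⟩
  rw [SimpleGraph.Walk.mem_support_append_iff] at hu
  rcases hu with hu | hu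
  · exact hp u (by simpa using hu)
  · exact hq u hu

lemma exists_centroid [Finite V] (hG : G.IsAcyclic) {C : Set V} (hne : C.Nonempty) :
    ∃ z ∈ C, ∀ w ∈ C, G.Adj z w → 2 * (C ∩ branch G z w).ncard ≤ C.ncard := by
  classical
  by_contra! hcon
  have hbig : ∀ m, ∀ z ∈ C, ∀ w ∈ C, G.Adj z w → C.ncard < 2 * (C ∩ branch G z w).ncard →
      (C ∩ branch G z w).ncard = m → False := by
    intro m
    induction m using Nat.strong_induction_on with
    | _ m ih =>
      intro z hz w hw hzw hlt hm
      obtain ⟨y, hy, hwy, hlty⟩ := hcon w hw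
      by_cases hyz : y = z
      · subst hyz
        have hdisj : Disjoint (C ∩ branch G y w) (C ∩ branch G w y) :=
          Set.disjoint_left.2 fun x hx hx' => disjoint_branch_swap hG hzw hx.2 hx'.2
        have := Set.ncard_union_eq hdisj (Set.toFinite _) (Set.toFinite _)
        have h2 := Set.ncard_le_ncard (s := C ∩ branch G y w ∪ C ∩ branch G w y) (t := C)
          (by grind) (Set.toFinite _)
        omega
      · have hsub : C ∩ branch G w y ⊆ C ∩ branch G z w := fun x hx =>
          ⟨hx.1, branch_subset_branch hG hzw hwy hyz hx.2⟩
        have hss : C ∩ branch G w y ⊂ C ∩ branch G z w := (Set.ssubset_iff_of_subset hsub).2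
          ⟨w, ⟨hw, self_mem_branch hzw.ne'⟩, fun h => notMem_branch w y h.2⟩
        have := Set.ncard_lt_ncard hss (Set.toFinite _)
        exact ih _ (by omega) w hw y hy hwy hlty rfl
  obtain ⟨z, hz⟩ := hne
  obtain ⟨w, hw, hzw, hlt⟩ := hcon z hz
  exact hbig _ z hz w hw hzw hlt rfl

lemma ncard_biUnion_branch [Finite V] (hG : G.IsAcyclic) (C : Set V) {z : V} (N : Finset V)
    (hN : ∀ w ∈ N, G.Adj z w) :
    (⋃ w ∈ N, C ∩ branch G z w).ncard = ∑ w ∈ N, (C ∩ branch G z w).ncard := by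
  classical
  induction N using Finset.induction with
  | empty => simp
  | insert a N ha ih =>
    rw [Finset.sum_insert ha, ← ih fun w hw => hN w (Finset.mem_insert_of_mem hw),
      Finset.set_biUnion_insert]
    refine Set.ncard_union_eq (Set.disjoint_left.2 fun x hx hx' => ?_) (Set.toFinite _)
      (Set.toFinite _)
    simp only [Set.mem_iUnion] at hx'
    obtain ⟨w, hw, hx'⟩ := hx'
    have := branch_unique hG (hN a (Finset.mem_insert_self _ _))
      (hN w (Finset.mem_insert_of_mem hw)) hx.2 hx'.2
    exact ha (this ▸ hw)

lemma sum_ncard_branch_lt [Finite V] (hG : G.IsAcyclic) {C : Set V} {z : V} (hz : z ∈ C)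
    (N : Finset V) (hN : ∀ w ∈ N, G.Adj z w) :
    ∑ w ∈ N, (C ∩ branch G z w).ncard < C.ncard := by
  rw [← ncard_biUnion_branch hG C N hN]
  refine Set.ncard_lt_ncard ((Set.ssubset_iff_of_subset ?_).2 ⟨z, hz, ?_⟩) (Set.toFinite _)
  · exact Set.iUnion₂_subset fun _ _ => Set.inter_subset_left
  · simp only [Set.mem_iUnion, not_exists]
    exact fun w _ h => notMem_branch z w h.2

lemma WalkConnected.ncard_le_sum [Finite V] (hG : G.IsAcyclic) {C : Set V}
    (hC : WalkConnected G C) {z : V} (hz : z ∈ C) (N : Finset V)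
    (hN : ∀ w, w ∈ N ↔ w ∈ C ∧ G.Adj z w) :
    C.ncard ≤ ∑ w ∈ N, (C ∩ branch G z w).ncard + 1 := by
  rw [← ncard_biUnion_branch hG C N fun w hw => ((hN w).1 hw).2]
  refine le_trans (Set.ncard_le_ncard (fun x hx => ?_) (Set.toFinite _))
    (Set.ncard_insert_le z _)
  by_cases hxz : x = z
  · exact Or.inl hxz
  · obtain ⟨w, h1, h2, h3⟩ := hC.exists_mem_branch hz hx hxz
    exact Or.inr (Set.mem_biUnion (Finset.mem_coe.2 ((hN w).2 ⟨h1, h2⟩)) ⟨hx, h3⟩)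

end Branch

section Strategy

variable {K : ℕ} {V V' : Type} {T : CGraph K V} {T' : CGraph K V'}

/-- Every edge leaving `C'` ends in a pebble whose counterpart lies outside `C`. -/
def Guarded (T' : CGraph K V') (S : Set (V × V')) (C : Set V) (C' : Set V') : Prop :=
  ∀ u' ∈ C', ∀ v' ∉ C', T'.graph.Adj u' v' → ∃ v ∉ C, (v, v') ∈ S

/-- `C` embeds into `C'` as an induced colored subgraph, respecting the pebbles in `C`. -/
def Embeds (T : CGraph K V) (T' : CGraph K V') (S : Set (V × V')) (C : Set V) (C' : Set V') :
    Prop :=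
  ∃ e : V → V', Set.MapsTo e C C' ∧ Set.InjOn e C ∧
    (∀ x ∈ C, ∀ y ∈ C, T.graph.Adj x y ↔ T'.graph.Adj (e x) (e y)) ∧
    (∀ x ∈ C, ∀ c, T.color c x ↔ T'.color c (e x)) ∧
    ∀ p ∈ S, p.1 ∈ C → e p.1 = p.2

lemma Guarded.mono {S S₁ : Set (V × V')} {C : Set V} {C' : Set V'} (h : Guarded T' S C C')
    (hS : S ⊆ S₁) : Guarded T' S₁ C C' := fun u' hu' v' hv' ha =>
  let ⟨v, h1, h2⟩ := h u' hu' v' hv' ha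
  ⟨v, h1, hS h2⟩

lemma Embeds.anti {S S₁ : Set (V × V')} {C : Set V} {C' : Set V'} (h : Embeds T T' S₁ C C')
    (hS : S ⊆ S₁) : Embeds T T' S C C' :=
  let ⟨e, h1, h2, h3, h4, h5⟩ := h
  ⟨e, h1, h2, h3, h4, fun p hp => h5 p (hS hp)⟩

lemma adj_iff_of_not_clash {S : Set (V × V')} (h : ¬ Clash T T' S) {p q : V} {p' q' : V'}
    (hp : (p, p') ∈ S) (hq : (q, q') ∈ S) : T.graph.Adj p q ↔ T'.graph.Adj p' q' := by
  by_contra hn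
  exact h ⟨_, hp, _, hq, Or.inl hn⟩

lemma eq_iff_of_not_clash {S : Set (V × V')} (h : ¬ Clash T T' S) {p q : V} {p' q' : V'}
    (hp : (p, p') ∈ S) (hq : (q, q') ∈ S) : p = q ↔ p' = q' := by
  by_contra hn
  exact h ⟨_, hp, _, hq, Or.inr (Or.inl hn)⟩

lemma color_iff_of_not_clash {S : Set (V × V')} (h : ¬ Clash T T' S) {p : V} {p' : V'}
    (hp : (p, p') ∈ S) (c : Fin K) : T.color c p ↔ T'.color c p' := by
  by_contra hn
  exact h ⟨_, hp, _, hp, Or.inr (Or.inr ⟨c, hn⟩)⟩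

/-- Spoiler wins by halving a path of `C` whose endpoints are answered on different sides
of `C'`. -/
lemma Guarded.spoilerWins {C : Set V} {C' : Set V'} (k : ℕ) {S : Set (V × V')}
    (hB : Guarded T' S C C') {p q : V} {p' q' : V'} (w : T.graph.Walk p q)
    (hw : ∀ u ∈ w.support, u ∈ C) (hlen : w.length ≤ 2 ^ k) (hp : (p, p') ∈ S) (hq : (q, q') ∈ S)
    (hp' : p' ∈ C') (hq' : q' ∉ C') : SpoilerWins T T' k S := by
  induction k generalizing S p q p' q' with
  | zero =>
    by_contra hcl
    change ¬ Clash T T' S at hcl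
    have hqC : q ∈ C := hw q w.end_mem_support
    have hne : p ≠ q := fun h => hq' ((eq_iff_of_not_clash hcl hp hq).1 h ▸ hp')
    have hadj : T.graph.Adj p q := by
      cases w with
      | nil => exact absurd rfl hne
      | cons h w =>
        cases w with
        | nil => exact h
        | cons h' w => simp at hlen
    obtain ⟨v, hv, hvS⟩ := hB p' hp' q' hq' ((adj_iff_of_not_clash hcl hp hq).1 hadj)
    exact hv ((eq_iff_of_not_clash hcl hvS hq).2 rfl ▸ hqC)
  | succ k ih =>
    refine Or.inr ⟨w.getVert (2 ^ k), fun u' => ?_⟩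
    have hsub : S ⊆ insert (w.getVert (2 ^ k), u') S := Set.subset_insert _ _
    by_cases hu' : u' ∈ C'
    · refine ih (hB.mono hsub) (w.drop (2 ^ k)) (fun u hu => hw u ?_) ?_ (Set.mem_insert _ _)
        (hsub hq) hu' hq'
      · rw [SimpleGraph.Walk.drop_support_eq_support_drop_min] at hu
        exact List.mem_of_mem_drop hu
      · rw [SimpleGraph.Walk.drop_length]
        rw [pow_succ] at hlen
        omega
    · refine ih (hB.mono hsub) (w.take (2 ^ k)) (fun u hu => hw u ?_) ?_ (hsub hp)
        (Set.mem_insert _ _) hp' hu'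
      · rw [SimpleGraph.Walk.support_take] at hu
        exact List.mem_of_mem_take hu
      · rw [SimpleGraph.Walk.take_length]
        exact min_le_left _ _

lemma Guarded.spoilerWins_of_card [Fintype V] {C : Set V} {C' : Set V'} {k : ℕ}
    (hk : Fintype.card V ≤ 2 ^ k) {S : Set (V × V')} (hC : WalkConnected T.graph C)
    (hB : Guarded T' S C C') {p q : V} {p' q' : V'} (hpC : p ∈ C) (hqC : q ∈ C)
    (hp : (p, p') ∈ S) (hq : (q, q') ∈ S) (hp' : p' ∈ C') (hq' : q' ∉ C') :
    SpoilerWins T T' k S := by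
  classical
  obtain ⟨w, hw⟩ := hC p hpC q hqC
  exact hB.spoilerWins k w.bypass (fun u hu => hw u (w.support_bypass_subset_support hu))
    (w.bypass_isPath.length_lt.le.trans hk) hp hq hp' hq'

lemma Guarded.inter_branch {S : Set (V × V')} {C : Set V} {C' : Set V'}
    (hB : Guarded T' S C C') {z : V} {z' : V'} (hz : (z, z') ∈ S) (w : V) (w' : V') :
    Guarded T' S (C ∩ branch T.graph z w) (C' ∩ branch T'.graph z' w') := by
  rintro u' ⟨hu'C, hu'⟩ v' hv' hadj
  by_cases hv'C : v' ∈ C'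
  · by_cases hvz : v' = z'
    · exact ⟨z, fun h => notMem_branch z w h.2, hvz ▸ hz⟩
    · exact absurd ⟨hv'C, mem_branch_of_adj hu' hadj hvz⟩ hv'
  · obtain ⟨v, hv, hvS⟩ := hB u' hu'C v' hv'C hadj
    exact ⟨v, fun h => hv h.1, hvS⟩

/-- Embeddings of all branches at `z` glue to an embedding of `C`. -/
lemma embeds_of_branches (hT : T.graph.IsAcyclic) (hT' : T'.graph.IsAcyclic) {S : Set (V × V')}
    {C : Set V} {C' : Set V'} (hC : WalkConnected T.graph C) {z : V} {z' : V'} (hzC : z ∈ C)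
    (hz'C : z' ∈ C') (hz : (z, z') ∈ S) (hcl : ¬ Clash T T' S) {r : V → V'}
    (hrS : ∀ w ∈ C, T.graph.Adj z w → (w, r w) ∈ S)
    (hr : ∀ w ∈ C, T.graph.Adj z w →
      Embeds T T' S (C ∩ branch T.graph z w) (C' ∩ branch T'.graph z' (r w))) :
    Embeds T T' S C C' := by
  classical
  have hradj : ∀ w ∈ C, T.graph.Adj z w → T'.graph.Adj z' (r w) := fun w hw h =>
    (adj_iff_of_not_clash hcl hz (hrS w hw h)).1 h
  have hb : ∀ x, ∃ w, x ∈ C → x ≠ z → w ∈ C ∧ T.graph.Adj z w ∧ x ∈ branch T.graph z w := by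
    intro x
    by_cases h : x ∈ C ∧ x ≠ z
    · obtain ⟨w, hw⟩ := hC.exists_mem_branch hzC h.1 h.2
      exact ⟨w, fun _ _ => hw⟩
    · exact ⟨x, fun h1 h2 => absurd ⟨h1, h2⟩ h⟩
  choose b hb using hb
  have hE : ∀ w, ∃ e : V → V', w ∈ C → T.graph.Adj z w →
      Set.MapsTo e (C ∩ branch T.graph z w) (C' ∩ branch T'.graph z' (r w)) ∧
      Set.InjOn e (C ∩ branch T.graph z w) ∧
      (∀ x ∈ C ∩ branch T.graph z w, ∀ y ∈ C ∩ branch T.graph z w,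
        T.graph.Adj x y ↔ T'.graph.Adj (e x) (e y)) ∧
      (∀ x ∈ C ∩ branch T.graph z w, ∀ c, T.color c x ↔ T'.color c (e x)) ∧
      ∀ p ∈ S, p.1 ∈ C ∩ branch T.graph z w → e p.1 = p.2 := by
    intro w
    by_cases h : w ∈ C ∧ T.graph.Adj z w
    · obtain ⟨e, he⟩ := hr w h.1 h.2
      exact ⟨e, fun _ _ => he⟩
    · exact ⟨fun _ => z', fun h1 h2 => absurd ⟨h1, h2⟩ h⟩
  choose E hE using hE
  have hne : ∀ x ∈ C, x ≠ z → E (b x) x ∈ C' ∩ branch T'.graph z' (r (b x)) := fun x hx hxz =>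
    let ⟨h1, h2, h3⟩ := hb x hx hxz
    (hE _ h1 h2).1 ⟨hx, h3⟩
  have hroot : ∀ x ∈ C, x ≠ z → (T.graph.Adj z x ↔ T'.graph.Adj z' (E (b x) x)) := by
    intro x hx hxz
    obtain ⟨h1, h2, h3⟩ := hb x hx hxz
    have hbE : E (b x) (b x) = r (b x) :=
      (hE _ h1 h2).2.2.2.2 _ (hrS _ h1 h2) ⟨h1, self_mem_branch h2.ne'⟩
    constructor
    · intro h
      have := eq_of_adj_of_mem_branch hT h2 h3 h
      rw [← this] at hbE
      rw [← this, hbE]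
      exact this ▸ hradj x hx h
    · intro h
      have := eq_of_adj_of_mem_branch hT' (hradj _ h1 h2) (hne x hx hxz).2 h
      rw [← hbE] at this
      rw [(hE _ h1 h2).2.1 ⟨hx, h3⟩ ⟨h1, self_mem_branch h2.ne'⟩ this]
      exact h2
  have hsame : ∀ x ∈ C, ∀ y ∈ C, x ≠ z → y ≠ z → r (b x) = r (b y) → b x = b y := by
    intro x hx y hy hxz hyz h
    obtain ⟨h1, h2, -⟩ := hb x hx hxz
    obtain ⟨k1, k2, -⟩ := hb y hy hyz
    exact (eq_iff_of_not_clash hcl (hrS _ h1 h2) (hrS _ k1 k2)).2 h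
  refine ⟨fun x => if x = z then z' else E (b x) x, ?_, ?_, ?_, ?_, ?_⟩
  · intro x hx
    by_cases hxz : x = z
    · simpa [hxz] using hz'C
    · simpa [hxz] using (hne x hx hxz).1
  · intro x hx y hy hxy
    by_cases hxz : x = z <;> by_cases hyz : y = z
    · rw [hxz, hyz]
    · simp only [hxz, hyz, if_true, if_false] at hxy
      exact absurd (hxy ▸ (hne y hy hyz).2) (notMem_branch _ _)
    · simp only [hxz, hyz, if_true, if_false] at hxy
      exact absurd (hxy ▸ (hne x hx hxz).2) (notMem_branch _ _)
    · simp only [hxz, hyz, if_false] at hxy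
      obtain ⟨h1, h2, h3⟩ := hb x hx hxz
      obtain ⟨k1, k2, k3⟩ := hb y hy hyz
      have hbb : b x = b y := hsame x hx y hy hxz hyz <|
        branch_unique hT' (hradj _ h1 h2) (hradj _ k1 k2) (hne x hx hxz).2
          (hxy ▸ (hne y hy hyz).2)
      rw [← hbb] at k3 hxy
      exact (hE _ h1 h2).2.1 ⟨hx, h3⟩ ⟨hy, k3⟩ hxy
  · intro x hx y hy
    by_cases hxz : x = z <;> by_cases hyz : y = z
    · simp [hxz, hyz]
    · simpa [hxz, hyz] using hroot y hy hyz
    · simpa [hxz, hyz, T.graph.adj_comm x z, T'.graph.adj_comm _ z'] using hroot x hx hxz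
    · simp only [hxz, hyz, if_false]
      obtain ⟨h1, h2, h3⟩ := hb x hx hxz
      obtain ⟨k1, k2, k3⟩ := hb y hy hyz
      by_cases hbb : b x = b y
      · rw [← hbb] at k3 ⊢
        exact (hE _ h1 h2).2.2.1 x ⟨hx, h3⟩ y ⟨hy, k3⟩
      · refine iff_of_false (fun h => hbb ?_)
          (fun h => hbb (hsame x hx y hy hxz hyz ?_))
        · exact branch_unique hT h2 k2 (mem_branch_of_adj h3 h hyz) k3
        · refine branch_unique hT' (hradj _ h1 h2) (hradj _ k1 k2)
            (mem_branch_of_adj (hne x hx hxz).2 h fun he => ?_) (hne y hy hyz).2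
          exact notMem_branch z' (r (b y)) (by simpa only [he] using (hne y hy hyz).2)
  · intro x hx c
    by_cases hxz : x = z
    · simpa [hxz] using color_iff_of_not_clash hcl hz c
    · obtain ⟨h1, h2, h3⟩ := hb x hx hxz
      simpa [hxz] using (hE _ h1 h2).2.2.2.1 x ⟨hx, h3⟩ c
  · rintro ⟨x, x'⟩ hp hx
    simp only at hx ⊢
    by_cases hxz : x = z
    · simpa [hxz] using (eq_iff_of_not_clash hcl hz hp).1 hxz.symm
    · obtain ⟨h1, h2, h3⟩ := hb x hx hxz
      simpa [hxz] using (hE _ h1 h2).2.2.2.2 _ hp ⟨hx, h3⟩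

/-- Spoiler, having pebbled `z`, pebbles the neighbors of `z` in `C` in order of decreasing branch
size until a branch is answered by a nonisomorphic branch that is not larger. -/
lemma spoilerWins_of_branches [Finite V] [Finite V'] (hT : T.graph.IsAcyclic)
    (hT' : T'.graph.IsAcyclic) {l k : ℕ} {g : ℕ → ℕ}
    (hg : ∀ m m' i, 1 ≤ m' → i ≤ l → i * m' ≤ m → 2 * m' ≤ m → g m' + i + 1 ≤ g m)
    {C : Set V} {C' : Set V'} (hC : WalkConnected T.graph C) {z : V} {z' : V'} (hzC : z ∈ C)
    (hz'C : z' ∈ C') (hcard : C'.ncard ≤ C.ncard)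
    (hzmid : ∀ w ∈ C, T.graph.Adj z w → 2 * (C ∩ branch T.graph z w).ncard ≤ C.ncard)
    (ih : ∀ (B : Set V) (B' : Set V') (S : Set (V × V')), B.ncard < C.ncard →
      WalkConnected T.graph B → Guarded T' S B B' → (∃ p ∈ S, p.1 ∈ B ∧ p.2 ∈ B') →
      B'.ncard ≤ B.ncard → ¬ Embeds T T' S B B' → SpoilerWins T T' (g B.ncard + k + 1) S)
    (N : Finset V) (hN : ∀ w, w ∈ N ↔ w ∈ C ∧ T.graph.Adj z w) (hNl : N.card ≤ l)
    (j : ℕ) {d : ℕ} {S : Set (V × V')} {H : Finset V} {r : V → V'} (hj : j + H.card = N.card)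
    (hHN : H ⊆ N) (hd : g C.ncard + k ≤ d + H.card) (hzS : (z, z') ∈ S)
    (hB : Guarded T' S C C') (hemb : ¬ Embeds T T' S C C') (hrS : ∀ h ∈ H, (h, r h) ∈ S)
    (hr : ∀ h ∈ H, (C ∩ branch T.graph z h).ncard < (C' ∩ branch T'.graph z' (r h)).ncard ∨
      Embeds T T' S (C ∩ branch T.graph z h) (C' ∩ branch T'.graph z' (r h)))
    (hmax : ∀ h ∈ H, ∀ w ∈ N, w ∉ H →
      (C ∩ branch T.graph z w).ncard ≤ (C ∩ branch T.graph z h).ncard) :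
    SpoilerWins T T' d S := by
  classical
  induction j generalizing d S H r with
  | zero =>
    obtain rfl : H = N := Finset.eq_of_subset_of_card_le hHN (by omega)
    refine Clash.spoilerWins ?_ d
    by_contra hcl
    have hadj' : ∀ h ∈ H, T'.graph.Adj z' (r h) := fun h hh =>
      (adj_iff_of_not_clash hcl hzS (hrS h hh)).1 ((hN h).1 hh).2
    by_cases hall : ∀ h ∈ H, Embeds T T' S (C ∩ branch T.graph z h)
        (C' ∩ branch T'.graph z' (r h))
    · exact hemb (embeds_of_branches hT hT' hC hzC hz'C hzS hcl
        (fun w h1 h2 => hrS w ((hN w).2 ⟨h1, h2⟩)) fun w h1 h2 => hall w ((hN w).2 ⟨h1, h2⟩))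
    · push Not at hall
      obtain ⟨h₀, hh₀, hne⟩ := hall
      have h1 := hC.ncard_le_sum hT hzC H hN
      have hinj : Set.InjOn r H := fun a ha b hb hab =>
        (eq_iff_of_not_clash hcl (hrS a ha) (hrS b hb)).2 hab
      have h2 := sum_ncard_branch_lt hT' hz'C (H.image r) (by
        simpa only [Finset.forall_mem_image] using hadj')
      rw [Finset.sum_image hinj] at h2
      have h3 : ∑ w ∈ H, (C ∩ branch T.graph z w).ncard <
          ∑ w ∈ H, (C' ∩ branch T'.graph z' (r w)).ncard := by
        refine Finset.sum_lt_sum (fun h hh => ?_) ⟨h₀, hh₀, (hr h₀ hh₀).resolve_right hne⟩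
        rcases hr h hh with hlt | ⟨e, he, hei, -⟩
        · exact hlt.le
        · exact Set.ncard_le_ncard_of_injOn e he hei (Set.toFinite _)
      omega
  | succ j ihj =>
    obtain ⟨w, hw, hwmax⟩ := Finset.exists_max_image (N \ H)
      (fun w => (C ∩ branch T.graph z w).ncard)
      (Finset.sdiff_nonempty.2 fun h => by have := Finset.card_le_card h; omega)
    obtain ⟨hwN, hwH⟩ := Finset.mem_sdiff.1 hw
    obtain ⟨hwC, hzw⟩ := (hN w).1 hwN
    have hwB : w ∈ C ∩ branch T.graph z w := ⟨hwC, self_mem_branch hzw.ne'⟩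
    have hpos : 1 ≤ (C ∩ branch T.graph z w).ncard :=
      (Set.ncard_pos (Set.toFinite _)).2 ⟨w, hwB⟩
    have hins : insert w H ⊆ N := Finset.insert_subset hwN hHN
    have hcardins : (insert w H).card = H.card + 1 := Finset.card_insert_of_notMem hwH
    have hsum := sum_ncard_branch_lt hT hzC (insert w H) fun v hv => ((hN v).1 (hins hv)).2
    have hlow : (insert w H).card * (C ∩ branch T.graph z w).ncard ≤
        ∑ v ∈ insert w H, (C ∩ branch T.graph z v).ncard := by
      rw [← smul_eq_mul]
      refine Finset.card_nsmul_le_sum _ _ _ fun v hv => ?_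
      rcases Finset.mem_insert.1 hv with rfl | hv
      · exact le_rfl
      · exact hmax v hv w hwN hwH
    have hbudget := hg C.ncard _ (insert w H).card hpos
      ((Finset.card_le_card hins).trans hNl) (hlow.trans hsum.le) (hzmid w hwC hzw)
    obtain ⟨d, rfl⟩ : ∃ d', d = d' + 1 := ⟨d - 1, by omega⟩
    refine Or.inr ⟨w, fun w' => ?_⟩
    set S₁ := insert (w, w') S with hS₁
    have hSS₁ : S ⊆ S₁ := Set.subset_insert _ _
    have hwS₁ : (w, w') ∈ S₁ := Set.mem_insert _ _
    by_cases hcl : Clash T T' S₁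
    · exact hcl.spoilerWins d
    have hzw' : T'.graph.Adj z' w' := (adj_iff_of_not_clash hcl (hSS₁ hzS) hwS₁).1 hzw
    have hw'C : w' ∈ C' := by
      by_contra hw'C
      refine hcl ((hB.mono hSS₁).spoilerWins 0 hzw.toWalk ?_ (by simp) (hSS₁ hzS) hwS₁ hz'C hw'C)
      intro u hu
      simp only [SimpleGraph.Adj.toWalk, SimpleGraph.Walk.support_cons,
        SimpleGraph.Walk.support_nil, List.mem_cons, List.not_mem_nil, or_false] at hu
      rcases hu with rfl | rfl <;> assumption
    by_cases hgood : (C ∩ branch T.graph z w).ncard < (C' ∩ branch T'.graph z' w').ncard ∨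
        Embeds T T' S₁ (C ∩ branch T.graph z w) (C' ∩ branch T'.graph z' w')
    · have hrup : ∀ h ∈ H, Function.update r w w' h = r h := fun h hh =>
        Function.update_of_ne (fun he : h = w => hwH (he ▸ hh)) _ _
      refine ihj (H := insert w H) (r := Function.update r w w') (by omega) hins (by omega)
        (hSS₁ hzS) (hB.mono hSS₁) (fun h => hemb (h.anti hSS₁)) ?_ ?_ ?_
      · intro h hh
        rcases Finset.mem_insert.1 hh with rfl | hh
        · simpa using hwS₁
        · rw [hrup h hh]
          exact hSS₁ (hrS h hh)
      · intro h hh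
        rcases Finset.mem_insert.1 hh with rfl | hh
        · simpa using hgood
        · rw [hrup h hh]
          refine (hr h hh).imp_right ?_
          rintro ⟨e, h1, h2, h3, h4, h5⟩
          refine ⟨e, h1, h2, h3, h4, fun p hp hpB => ?_⟩
          rcases hp with rfl | hp
          · have : w = h := eq_of_adj_of_mem_branch hT ((hN h).1 (hHN hh)).2 hpB.2 hzw
            exact absurd (this ▸ hh) hwH
          · exact h5 p hp hpB
      · intro h hh v hv hvH
        rw [Finset.mem_insert, not_or] at hvH
        rcases Finset.mem_insert.1 hh with rfl | hh
        · exact hwmax v (Finset.mem_sdiff.2 ⟨hv, hvH.2⟩)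
        · exact hmax h hh v hv hvH.2
    · rw [not_or, not_lt] at hgood
      have hlt : (C ∩ branch T.graph z w).ncard < C.ncard := by
        have := hzmid w hwC hzw
        omega
      exact (ih _ _ S₁ hlt (hC.inter_branch hT hzC hzw)
        ((hB.mono hSS₁).inter_branch (hSS₁ hzS) w w')
        ⟨_, hwS₁, hwB, hw'C, self_mem_branch hzw'.ne'⟩ hgood.1 hgood.2).mono (by omega)

lemma spoilerWins_of_not_embeds [Fintype V] [Finite V'] (hT : T.graph.IsAcyclic)
    (hT' : T'.graph.IsAcyclic) {l k : ℕ} (hk : Fintype.card V ≤ 2 ^ k)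
    (hl : ∀ v, deg T.graph v ≤ l) {g : ℕ → ℕ}
    (hg : ∀ m m' i, 1 ≤ m' → i ≤ l → i * m' ≤ m → 2 * m' ≤ m → g m' + i + 1 ≤ g m)
    {C : Set V} {C' : Set V'} {S : Set (V × V')} (hC : WalkConnected T.graph C)
    (hB : Guarded T' S C C') (hS : ∃ p ∈ S, p.1 ∈ C ∧ p.2 ∈ C') (hcard : C'.ncard ≤ C.ncard)
    (hemb : ¬ Embeds T T' S C C') : SpoilerWins T T' (g C.ncard + k + 1) S := by
  classical
  induction hm : C.ncard using Nat.strong_induction_on generalizing C C' S with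
  | _ m ih =>
    subst hm
    obtain ⟨⟨p, p'⟩, hpS, hpC, hpC'⟩ := hS
    obtain ⟨z, hzC, hzmid⟩ := exists_centroid hT ⟨p, hpC⟩
    refine Or.inr ⟨z, fun z' => ?_⟩
    have hsub : S ⊆ insert (z, z') S := Set.subset_insert _ _
    by_cases hz'C : z' ∈ C'
    · refine spoilerWins_of_branches hT hT' (l := l) (k := k) hg hC hzC hz'C hcard hzmid
        (fun B B' S h1 h2 h3 h4 h5 h6 => ih _ h1 h2 h3 h4 h5 h6 rfl)
        (Finset.univ.filter fun w => w ∈ C ∧ T.graph.Adj z w) (by simp) ?_ _ (H := ∅)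
        (r := fun _ => z') (by simp; rfl) (by simp) (by simp) (Set.mem_insert _ _)
        (hB.mono hsub) (fun h => hemb (h.anti hsub)) (by simp) (by simp) (by simp)
      refine le_trans ?_ (hl z)
      rw [deg, Nat.card_eq_fintype_card, Fintype.card_subtype]
      exact Finset.card_le_card fun w hw => by simp_all
    · exact ((hB.mono hsub).spoilerWins_of_card hk hC hpC hzC (hsub hpS) (Set.mem_insert _ _)
        hpC' hz'C).mono (by omega)

lemma exists_formula_of_not_cIso {k n n' l : ℕ} {T : CGraph k (Fin n)} {T' : CGraph k (Fin n')}
    (hT : IsColTree T) (hT' : IsColTree T') (hiso : ¬ CIso T T') (hn : n' ≤ n)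
    (hl : ∀ v, deg T.graph v ≤ l) {g : ℕ → ℕ}
    (hg : ∀ m m' i, 1 ≤ m' → i ≤ l → i * m' ≤ m → 2 * m' ≤ m → g m' + i + 1 ≤ g m) :
    ∃ φ : CForm k 0, φ.exOnly ∧ φ.depth ≤ g n + Nat.log 2 n + 3 ∧ CSat T φ ∧ ¬ CSat T' φ := by
  refine SpoilerWins.exists_formula (T := T) (T' := T') (Or.inr ?_)
  have hne := hT.1.nonempty
  refine ⟨Classical.arbitrary _, fun v' => ?_⟩
  have hk : Fintype.card (Fin n) ≤ 2 ^ (Nat.log 2 n + 1) := by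
    simpa using (Nat.lt_pow_succ_log_self one_lt_two n).le
  have := spoilerWins_of_not_embeds (T := T) (T' := T') hT.2 hT'.2 hk hl hg
    (C := Set.univ) (C' := Set.univ)
    (S := insert (Classical.arbitrary _, v') (Set.range fun i : Fin 0 => (![] i, ![] i)))
    (fun x _ y _ => let ⟨p⟩ := hT.1.preconnected x y; ⟨p, fun _ _ => trivial⟩)
    (fun _ _ _ h => absurd trivial h) ⟨_, Set.mem_insert _ _, trivial, trivial⟩
    (by simpa [Set.ncard_univ] using hn) ?_
  · simpa [Set.ncard_univ, add_assoc] using this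
  · rintro ⟨e, -, he, hadj, hcol, -⟩
    have hinj : Function.Injective e := Set.injOn_univ.1 he
    have hbij : Function.Bijective e := (Fintype.bijective_iff_injective_and_card e).2
      ⟨hinj, le_antisymm (Fintype.card_le_of_injective e hinj) (by simpa using hn)⟩
    exact hiso ⟨Equiv.ofBijective e hbij, fun v w => hadj v trivial w trivial,
      fun c v => hcol v trivial c⟩

end Strategy

/-- The number of rounds Spoiler needs to descend from size `m` to a single vertex. -/
lemma descent_cost {l : ℕ} (m m' i : ℕ) (hm' : 1 ≤ m') (hil : i ≤ l)
    (him : i * m' ≤ m) (h2m : 2 * m' ≤ m) :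
    ⌊(l / Real.log l + 5) * Real.log m'⌋₊ + i + 1 ≤ ⌊(l / Real.log l + 5) * Real.log m⌋₊ := by
  have hlog : 0 ≤ Real.log l := Real.log_natCast_nonneg l
  have hc : 0 ≤ (l : ℝ) / Real.log l := by positivity
  have hm'0 : (0 : ℝ) < m' := by exact_mod_cast hm'
  have key : (i : ℝ) + 1 ≤ (l / Real.log l + 5) * (Real.log m - Real.log m') := by
    have hdrop : ∀ t : ℕ, 0 < t → t * m' ≤ m → Real.log t ≤ Real.log m - Real.log m' := by
      intro t ht h
      have h1 : (t : ℝ) * m' ≤ m := by exact_mod_cast h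
      have ht' : (0 : ℝ) < t := by exact_mod_cast ht
      have := Real.log_le_log (by positivity) h1
      rw [Real.log_mul ht'.ne' hm'0.ne'] at this
      linarith
    rcases lt_or_ge i 3 with hi3 | hi3
    · have h1 := hdrop 2 two_pos h2m
      have h2 := Real.log_two_gt_d9
      have h3 : (i : ℝ) ≤ 2 := by exact_mod_cast Nat.lt_succ_iff.1 hi3
      push_cast at h1
      nlinarith [mul_nonneg hc (by linarith : 0 ≤ Real.log m - Real.log m')]
    · have h1 := hdrop i (by omega) him
      have hi3' : (3 : ℝ) ≤ i := by exact_mod_cast hi3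
      have hil' : (i : ℝ) ≤ l := by exact_mod_cast hil
      have he : Real.exp 1 ≤ 3 := by linarith [Real.exp_one_lt_d9]
      have hlogi : 1 ≤ Real.log i := by
        rw [Real.le_log_iff_exp_le (by linarith)]
        linarith
      have hlogl : 1 ≤ Real.log l := hlogi.trans (Real.log_le_log (by linarith) hil')
      have hmono := Real.log_div_self_antitoneOn (a := (i : ℝ)) (b := (l : ℝ))
        (by simp only [Set.mem_Ici]; linarith) (by simp only [Set.mem_Ici]; linarith) hil'
      simp only at hmono
      have h4 : (i : ℝ) ≤ l / Real.log l * Real.log i := by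
        rw [div_le_div_iff₀ (by linarith) (by linarith)] at hmono
        rw [div_mul_eq_mul_div, le_div_iff₀ (by linarith)]
        linarith
      calc (i : ℝ) + 1 ≤ (l / Real.log l + 5) * Real.log i := by nlinarith
        _ ≤ _ := by gcongr
  have hnn : 0 ≤ (l / Real.log l + 5) * Real.log m' :=
    mul_nonneg (by linarith) (Real.log_natCast_nonneg m')
  refine Nat.le_floor ?_
  push_cast
  have := Nat.floor_le hnn
  linarith

end FODef

theorem statement8 (ε : ℝ) (hε : 0 < ε) :
    ∃ (L : ℕ) (K : ℝ), ∀ (k n n' l : ℕ) (T : CGraph k (Fin n)) (T' : CGraph k (Fin n')),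
      IsColTree T → IsColTree T' → ¬ CIso T T' → n' ≤ n →
      (∀ v, deg T.graph v ≤ l) → L ≤ l → K ≤ Real.log n / Real.log l →
      ∃ φ : CForm k 0, φ.exOnly ∧
        (φ.depth : ℝ) ≤ (1 + ε) * ((l : ℝ) * Real.log n / Real.log l) ∧
        CSat T φ ∧ ¬ CSat T' φ := by
  have hsmall : ∀ᶠ l : ℕ in atTop, Real.log l ≤ ε / 10 * l := by
    have h := (Real.isLittleO_log_id_atTop.comp_tendsto tendsto_natCast_atTop_atTop).bound
      (show 0 < ε / 10 by positivity)
    filter_upwards [h] with l hl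
    simpa [abs_of_nonneg (Real.log_natCast_nonneg l)] using hl
  obtain ⟨L, hL⟩ := eventually_atTop.1 hsmall
  refine ⟨max L 3, 1, fun k n n' l T T' hT hT' hiso hn hdeg hLl hK => ?_⟩
  obtain ⟨φ, h1, h2, h3⟩ := exists_formula_of_not_cIso hT hT' hiso hn hdeg
    (g := fun m => ⌊(l / Real.log l + 5) * Real.log m⌋₊) descent_cost
  refine ⟨φ, h1, ?_, h3⟩
  have hl3 : (3 : ℝ) ≤ l := by exact_mod_cast (le_max_right L 3).trans hLl
  have hlogl : 1 ≤ Real.log l := by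
    rw [Real.le_log_iff_exp_le (by linarith)]
    linarith [Real.exp_one_lt_d9]
  have hlogn : 1 ≤ Real.log n := by
    rw [le_div_iff₀ (by linarith)] at hK
    linarith
  have hn0 : n ≠ 0 := by
    rintro rfl
    norm_num at hlogn
  have hratio : 10 ≤ ε * (l / Real.log l) := by
    have := hL l ((le_max_left L 3).trans hLl)
    rw [← mul_div_assoc, le_div_iff₀ (by linarith)]
    linarith
  have hlog2 : (Nat.log 2 n : ℝ) ≤ 2 * Real.log n := by
    have hp : ((2 : ℝ) ^ Nat.log 2 n) ≤ n := by exact_mod_cast Nat.pow_log_le_self 2 hn0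
    have := Real.log_le_log (by positivity) hp
    rw [Real.log_pow] at this
    have h2 := Real.log_two_gt_d9
    nlinarith [(Nat.cast_nonneg (Nat.log 2 n) : (0 : ℝ) ≤ _)]
  have hfloor : (⌊(l / Real.log l + 5) * Real.log n⌋₊ : ℝ) ≤
      (l / Real.log l + 5) * Real.log n := Nat.floor_le (by positivity)
  have hdepth : (φ.depth : ℝ) ≤
      ⌊(l / Real.log l + 5) * Real.log n⌋₊ + Nat.log 2 n + 3 := by exact_mod_cast h2
  calc (φ.depth : ℝ) ≤ (l / Real.log l + 10) * Real.log n := by linarith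
    _ ≤ (l / Real.log l + ε * (l / Real.log l)) * Real.log n := by gcongr
    _ = (1 + ε) * (l * Real.log n / Real.log l) := by ring
end

section
/- There is a constant M such that for all n, all integers k with 1 ≤ k ≤ ln⁴ n, and all integers ℓ with 0 ≤ ℓ ≤ k − 1, the probability that the uniformly random forest F(n,k) contains exactly ℓ isolated vertices equals (1 + θ) · C(k−1, ℓ) · e^{−ℓ} · (1 − e^{−1})^{k−ℓ−1} for some real θ with |θ| ≤ M k² / n. -/
namespace FODef

/-- `F` belongs to `F_{n,k}`: it is a forest on `{0, …, n-1}` consisting of `k` trees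
rooted at the first `k` vertices, i.e. it is acyclic and each component contains exactly
one of the first `k` vertices (equivalently, every vertex is connected to exactly one
root). -/
def IsRootedForest (n k : ℕ) (F : SimpleGraph (Fin n)) : Prop :=
  F.IsAcyclic ∧ ∀ v : Fin n, ∃! r : Fin n, r.val < k ∧ F.Reachable v r

open Classical in
/-- The probability of the event `E` for a forest chosen uniformly at random
from `F_{n,k}`. -/
noncomputable def rfProb (n k : ℕ) (E : Set (SimpleGraph (Fin n))) : ℝ :=
  ((Finset.univ.filter
      (fun F : SimpleGraph (Fin n) => IsRootedForest n k F ∧ F ∈ E)).card : ℝ) /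
  ((Finset.univ.filter (fun F : SimpleGraph (Fin n) => IsRootedForest n k F)).card : ℝ)

open Classical in
/-- The expectation of `X` for a forest chosen uniformly at random from `F_{n,k}`. -/
noncomputable def rfExp (n k : ℕ) (X : SimpleGraph (Fin n) → ℝ) : ℝ :=
  (∑ F ∈ Finset.univ.filter (fun F : SimpleGraph (Fin n) => IsRootedForest n k F), X F) /
  ((Finset.univ.filter (fun F : SimpleGraph (Fin n) => IsRootedForest n k F)).card : ℝ)

end FODef

namespace FODef

/-- The number of isolated vertices of a graph. -/
noncomputable def isolCount {n : ℕ} (F : SimpleGraph (Fin n)) : ℕ :=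
  Nat.card {v : Fin n // ∀ w, ¬ F.Adj v w}

end FODef

open FODef

section ParentMap

open Function

variable {V : Type*}

/-- `p` fixes the roots `R`, and iterating `p` from any vertex eventually reaches a root. -/
def IsParentMap (R : Finset V) (p : V → V) : Prop :=
  (∀ r ∈ R, p r = r) ∧ ∀ v, ∃ m, p^[m] v ∈ R

/-- The graph joining every vertex to its image under `p`. -/
def parentGraph (p : V → V) : SimpleGraph V :=
  SimpleGraph.fromRel fun v w => p v = w

/-- `G` is acyclic and every vertex is connected to exactly one vertex of `R`. -/
def IsForestRootedAt (R : Finset V) (G : SimpleGraph V) : Prop :=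
  G.IsAcyclic ∧ ∀ v, ∃! r, r ∈ R ∧ G.Reachable v r

theorem parentGraph_adj {p : V → V} {v w : V} :
    (parentGraph p).Adj v w ↔ v ≠ w ∧ (p v = w ∨ p w = v) := by
  simp [parentGraph]

namespace IsParentMap

variable {R : Finset V} {p q : V → V}

theorem iterate_eq (hp : IsParentMap R p) {r : V} (hr : r ∈ R) (m : ℕ) : p^[m] r = r :=
  iterate_fixed (hp.1 r hr) m

theorem iterate_unique (hp : IsParentMap R p) {v a b : V} (ha : a ∈ R) (hb : b ∈ R) {i j : ℕ}
    (hi : p^[i] v = a) (hj : p^[j] v = b) : a = b := by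
  have h₁ : p^[j + i] v = a := by rw [iterate_add_apply, hi, hp.iterate_eq ha]
  have h₂ : p^[i + j] v = b := by rw [iterate_add_apply, hj, hp.iterate_eq hb]
  rw [← h₁, ← h₂, add_comm]

theorem apply_ne (hp : IsParentMap R p) {v : V} (hv : v ∉ R) : p v ≠ v := by
  intro h
  obtain ⟨m, hm⟩ := hp.2 v
  rw [iterate_fixed h] at hm
  exact hv hm

theorem exists_height (hp : IsParentMap R p) : ∃ h : V → ℕ, ∀ v ∉ R, h (p v) < h v := by
  classical
  refine ⟨fun v => Nat.find (hp.2 v), fun v hv => ?_⟩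
  have hs := Nat.find_spec (hp.2 v)
  obtain h0 | hm := Nat.eq_zero_or_eq_succ_pred (Nat.find (hp.2 v))
  · rw [h0] at hs
    exact absurd hs hv
  · have : Nat.find (hp.2 (p v)) ≤ (Nat.find (hp.2 v)).pred := by
      apply Nat.find_min'
      rw [hm, iterate_succ_apply] at hs
      exact hs
    change Nat.find (hp.2 (p v)) < Nat.find (hp.2 v)
    omega

theorem isAcyclic [Finite V] (hp : IsParentMap R p) : (parentGraph p).IsAcyclic := by
  classical
  obtain ⟨h, hh⟩ := hp.exists_height
  intro v c hc
  obtain ⟨x, hx, hmax⟩ := Finset.exists_max_image c.support.toFinset h ⟨v, by simp⟩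
  have hx' : x ∈ c.support := by simpa using hx
  have hc' := hc.rotate hx'
  have key : ∀ y ∈ (c.rotate x hx').support, (parentGraph p).Adj x y → p x = y := by
    intro y hy hadj
    rw [parentGraph_adj] at hadj
    refine hadj.2.resolve_right fun hyx => ?_
    have hyR : y ∉ R := fun hyR => hadj.1 (by rw [← hyx, hp.1 y hyR])
    have h1 := hh y hyR
    rw [hyx] at h1
    have h2 := hmax y (by simpa using hy)
    omega
  have h1 := key _ (by simp) ((c.rotate x hx').adj_snd hc'.not_nil)
  have h2 := key _ (by simp) ((c.rotate x hx').adj_penultimate hc'.not_nil).symm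
  exact hc'.snd_ne_penultimate (h1.symm.trans h2)

theorem reachable_iterate (p : V → V) (v : V) (m : ℕ) :
    (parentGraph p).Reachable v (p^[m] v) := by
  induction m with
  | zero => simp
  | succ m ih =>
    rw [iterate_succ_apply']
    refine ih.trans ?_
    by_cases h : p^[m] v = p (p^[m] v)
    · rw [← h]
    · exact (parentGraph_adj.2 ⟨h, Or.inl rfl⟩).reachable

theorem exists_iterate_of_walk (hp : IsParentMap R p) {v r : V} (hr : r ∈ R)
    (c : (parentGraph p).Walk v r) : ∃ m, p^[m] v = r := by
  induction c with
  | nil => exact ⟨0, rfl⟩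
  | @cons u w r hadj c ih =>
    obtain ⟨m, hm⟩ := ih hr
    obtain h | h := (parentGraph_adj.1 hadj).2
    · exact ⟨m + 1, by rw [iterate_succ_apply, h, hm]⟩
    · refine ⟨m, ?_⟩
      rw [← h, ← iterate_succ_apply, iterate_succ_apply', hm, hp.1 r hr]

theorem isForestRootedAt [Finite V] (hp : IsParentMap R p) :
    IsForestRootedAt R (parentGraph p) := by
  refine ⟨hp.isAcyclic, fun v => ?_⟩
  obtain ⟨m, hm⟩ := hp.2 v
  refine ⟨_, ⟨hm, reachable_iterate p v m⟩, ?_⟩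
  rintro r ⟨hr, ⟨c⟩⟩
  obtain ⟨j, hj⟩ := hp.exists_iterate_of_walk hr c
  exact hp.iterate_unique hr hm hj rfl

theorem eq_of_parentGraph_eq (hp : IsParentMap R p) (hq : IsParentMap R q)
    (h : parentGraph p = parentGraph q) : p = q := by
  have key : ∀ m v, p^[m] v ∈ R → p v = q v := by
    intro m
    induction m with
    | zero => exact fun v hv => (hp.1 v hv).trans (hq.1 v hv).symm
    | succ m ih =>
      intro v hv
      rw [iterate_succ_apply] at hv
      by_cases hvR : v ∈ R
      · exact (hp.1 v hvR).trans (hq.1 v hvR).symm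
      have hadj : (parentGraph q).Adj v (p v) :=
        h ▸ parentGraph_adj.2 ⟨(hp.apply_ne hvR).symm, Or.inl rfl⟩
      refine ((parentGraph_adj.1 hadj).2.resolve_right fun hqv => ?_).symm
      have hpv : p (p v) = v := (ih _ hv).trans hqv
      obtain ⟨g, hg⟩ := hp.exists_height
      have h1 := hg v hvR
      by_cases hw : p v ∈ R
      · exact hp.apply_ne hvR ((hp.1 _ hw).symm.trans hpv)
      · have h2 := hg _ hw
        rw [hpv] at h2
        omega
  funext v
  obtain ⟨m, hm⟩ := hp.2 v
  exact key m v hm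

theorem isolated_iff (hp : IsParentMap R p) {v : V} :
    (∀ w, ¬ (parentGraph p).Adj v w) ↔ v ∈ R ∧ ∀ w ∉ R, p w ≠ v := by
  constructor
  · intro h
    have hv : v ∈ R := by
      by_contra hv
      exact h (p v) (parentGraph_adj.2 ⟨(hp.apply_ne hv).symm, Or.inl rfl⟩)
    refine ⟨hv, fun w hw hwv => h w (parentGraph_adj.2 ⟨?_, Or.inr hwv⟩)⟩
    rintro rfl
    exact hw hv
  · rintro ⟨hv, h⟩ w hadj
    obtain ⟨hne, hvw | hwv⟩ := parentGraph_adj.1 hadj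
    · exact hne ((hp.1 v hv).symm.trans hvw)
    · exact h w (fun hw => hne (by rw [← hwv, hp.1 w hw])) hwv

end IsParentMap

theorem IsForestRootedAt.exists_parentMap {R : Finset V} {G : SimpleGraph V}
    (hG : IsForestRootedAt R G) : ∃ p, IsParentMap R p ∧ parentGraph p = G := by
  classical
  obtain ⟨hac, hroot⟩ := hG
  choose root hroot huniq using hroot
  choose P hP using fun v => (hroot v).2.exists_isPath
  have hsnd : ∀ {v r : V} (c : G.Walk v r), c.IsPath → r ∈ R → (P v).snd = c.snd := by
    intro v r c hc hr
    obtain rfl := huniq v r ⟨hr, c.reachable⟩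
    rw [Subtype.mk.inj ((hac.subsingleton_path _ _).elim ⟨P v, hP v⟩ ⟨c, hc⟩)]
  refine ⟨fun v => (P v).snd, ⟨fun r hr => hsnd (SimpleGraph.Walk.nil' r) (by simp) hr, ?_⟩, ?_⟩
  · have key : ∀ {v r : V} (c : G.Walk v r), c.IsPath → r ∈ R →
        ∃ m, (fun v => (P v).snd)^[m] v ∈ R := by
      intro v r c
      induction c with
      | nil => exact fun _ hr => ⟨0, hr⟩
      | @cons u w r hadj c ih =>
        intro hc hr
        obtain ⟨m, hm⟩ := ih hc.of_cons hr
        refine ⟨m + 1, ?_⟩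
        rw [iterate_succ_apply]
        simpa [hsnd _ hc hr] using hm
    exact fun v => key (P v) (hP v) (hroot v).1
  · have hadj_snd : ∀ {v r : V} (c : G.Walk v r), v ≠ c.snd → G.Adj v c.snd := by
      intro v r c hne
      cases c with
      | nil => exact absurd rfl hne
      | cons h c => simpa using h
    ext v w
    rw [parentGraph_adj]
    constructor
    · rintro ⟨hne, h | h⟩
      · exact h ▸ hadj_snd (P v) (h ▸ hne)
      · exact (h ▸ hadj_snd (P w) (h ▸ hne.symm)).symm
    · intro hadj
      refine ⟨hadj.ne, ?_⟩
      by_cases hw : w ∈ (P v).support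
      · exact Or.inl (hac.eq_snd_of_adj_start (hP v) hadj hw).symm
      · right
        simpa using hsnd (SimpleGraph.Walk.cons hadj.symm (P v)) ((hP v).cons hw) (hroot v).1

end ParentMap

section Counting

open Function Finset

theorem IsParentMap.update_iterate_ne {V : Type*} [DecidableEq V] {R : Finset V} {u : V}
    {p : V → V} (hp : IsParentMap R p) (hu : u ∉ R) (m : ℕ) : (update p u u)^[m] (p u) ≠ u := by
  have hlift : ∀ m v, (update p u u)^[m] v = u → ∃ j, p^[j] v = u := by
    intro m
    induction m with
    | zero => exact fun v hv => ⟨0, hv⟩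
    | succ m ih =>
      intro v hv
      by_cases hvu : v = u
      · exact ⟨0, hvu⟩
      · rw [iterate_succ_apply, update_of_ne hvu] at hv
        obtain ⟨j, hj⟩ := ih _ hv
        exact ⟨j + 1, hj⟩
  intro hm
  obtain ⟨j, hj⟩ := hlift m _ hm
  rw [← iterate_succ_apply] at hj
  obtain ⟨i, hi⟩ := hp.2 u
  have h1 : p^[(j + 1) * i] u = u := by
    rw [iterate_mul]
    exact iterate_fixed hj i
  have h2 : p^[(j + 1) * i] u = p^[i] u := by
    rw [add_one_mul, iterate_add_apply]
    exact hp.iterate_eq hi _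
  rw [← h2, h1] at hi
  exact hu hi

variable {V : Type*} [Fintype V] [DecidableEq V]

open Classical in
/-- The parent maps with root set `R` for which no vertex outside `R` is mapped into `S`. -/
noncomputable def parentMapsAvoiding (R S : Finset V) : Finset (V → V) :=
  univ.filter fun p => IsParentMap R p ∧ ∀ v ∉ R, p v ∉ S

theorem mem_parentMapsAvoiding {R S : Finset V} {p : V → V} :
    p ∈ parentMapsAvoiding R S ↔ IsParentMap R p ∧ ∀ v ∉ R, p v ∉ S := by
  simp [parentMapsAvoiding]

theorem iterate_notMem {R S : Finset V} {p : V → V} (hp : p ∈ parentMapsAvoiding R S) {v : V}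
    (hv : v ∉ S) (m : ℕ) : p^[m] v ∉ S := by
  rw [mem_parentMapsAvoiding] at hp
  induction m with
  | zero => exact hv
  | succ m ih =>
    rw [iterate_succ_apply']
    by_cases h : p^[m] v ∈ R
    · rwa [hp.1.1 _ h]
    · exact hp.2 _ h

theorem update_mem_parentMapsAvoiding {R S : Finset V} {u w : V} {p : V → V} (hu : u ∉ R)
    (hp : p ∈ parentMapsAvoiding (insert u R) S) (hwS : w ∉ S) (hw : ∀ m, p^[m] w ≠ u) :
    update p u w ∈ parentMapsAvoiding R S := by
  rw [mem_parentMapsAvoiding] at hp ⊢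
  obtain ⟨⟨hfix, hreach⟩, havoid⟩ := hp
  have hne : ∀ {v}, v ≠ u → update p u w v = p v := fun h => update_of_ne h _ _
  have hiter : ∀ m, (update p u w)^[m] w = p^[m] w := by
    intro m
    induction m with
    | zero => rfl
    | succ m ih => rw [iterate_succ_apply', iterate_succ_apply', ih, hne (hw m)]
  have hureach : ∃ j, (update p u w)^[j] u ∈ R := by
    obtain ⟨m, hm⟩ := hreach w
    refine ⟨m + 1, ?_⟩
    rw [iterate_succ_apply, update_self, hiter]
    exact (mem_insert.1 hm).resolve_left (hw m)
  refine ⟨⟨fun r hr => ?_, fun v => ?_⟩, fun v hv => ?_⟩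
  · rw [hne (ne_of_mem_of_not_mem hr hu), hfix r (mem_insert_of_mem hr)]
  · obtain ⟨m, hm⟩ := hreach v
    induction m generalizing v with
    | zero =>
      obtain rfl | h := mem_insert.1 hm
      · exact hureach
      · exact ⟨0, h⟩
    | succ m ih =>
      by_cases hvu : v = u
      · exact hvu ▸ hureach
      · obtain ⟨j, hj⟩ := ih (p v) hm
        exact ⟨j + 1, by rwa [iterate_succ_apply, hne hvu]⟩
  · by_cases hvu : v = u
    · rwa [hvu, update_self]
    · rw [hne hvu]
      exact havoid v (by simp [hvu, hv])

theorem update_self_mem_parentMapsAvoiding {R S : Finset V} {u : V} {p : V → V}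
    (hp : p ∈ parentMapsAvoiding R S) :
    update p u u ∈ parentMapsAvoiding (insert u R) S := by
  rw [mem_parentMapsAvoiding] at hp ⊢
  obtain ⟨⟨hfix, hreach⟩, havoid⟩ := hp
  have hne : ∀ {v}, v ≠ u → update p u u v = p v := fun h => update_of_ne h _ _
  refine ⟨⟨fun r hr => ?_, fun v => ?_⟩, fun v hv => ?_⟩
  · by_cases hru : r = u
    · rw [hru, update_self]
    · rw [hne hru, hfix r ((mem_insert.1 hr).resolve_left hru)]
  · obtain ⟨m, hm⟩ := hreach v
    induction m generalizing v with
    | zero => exact ⟨0, mem_insert_of_mem hm⟩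
    | succ m ih =>
      by_cases hvu : v = u
      · exact ⟨0, by simp [hvu]⟩
      · obtain ⟨j, hj⟩ := ih (p v) hm
        exact ⟨j + 1, by rwa [iterate_succ_apply, hne hvu]⟩
  · rw [mem_insert, not_or] at hv
    rw [hne hv.1]
    exact havoid v hv.2

open Classical in
/-- Pairs of a parent map avoiding `S` and a vertex outside `S` in the tree rooted at `a`. -/
noncomputable def treePairs (R S : Finset V) (a : V) : Finset ((V → V) × V) :=
  (parentMapsAvoiding R S ×ˢ Sᶜ).filter fun x => ∃ m, x.1^[m] x.2 = a

theorem mem_treePairs {R S : Finset V} {a : V} {x : (V → V) × V} :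
    x ∈ treePairs R S a ↔ x.1 ∈ parentMapsAvoiding R S ∧ x.2 ∉ S ∧ ∃ m, x.1^[m] x.2 = a := by
  simp [treePairs, and_assoc]

theorem card_parentMapsAvoiding_add {R S : Finset V} {u : V} (hu : u ∉ R) :
    (parentMapsAvoiding R S).card + (treePairs (insert u R) S u).card =
      (parentMapsAvoiding (insert u R) S).card * Sᶜ.card := by
  classical
  rw [← card_product, ← card_filter_add_card_filter_not (s := parentMapsAvoiding (insert u R) S ×ˢ Sᶜ)
    (fun x : (V → V) × V => ∃ m, x.1^[m] x.2 = u), add_comm, treePairs]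
  congr 1
  refine card_bij' (fun (p : V → V) _ => (update p u u, p u)) (fun x _ => update x.1 u x.2) ?_ ?_ ?_ ?_
  · intro p hp
    have hp' := mem_parentMapsAvoiding.1 hp
    simp only [mem_filter, mem_product, mem_compl, not_exists]
    exact ⟨⟨update_self_mem_parentMapsAvoiding hp, hp'.2 u hu⟩, hp'.1.update_iterate_ne hu⟩
  · intro x hx
    simp only [mem_filter, mem_product, mem_compl, not_exists] at hx
    exact update_mem_parentMapsAvoiding hu hx.1.1 hx.1.2 hx.2
  · simp
  · intro x hx
    simp only [mem_filter, mem_product] at hx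
    have := (mem_parentMapsAvoiding.1 hx.1.1).1.1 u (mem_insert_self u R)
    ext1
    · simp only [update_idem]
      conv_rhs => rw [← update_eq_self u x.1, this]
    · simp

theorem card_treePairs_le {R S : Finset V} {a b : V} (ha : a ∈ R \ S) (hb : b ∈ R \ S) :
    (treePairs R S a).card ≤ (treePairs R S b).card := by
  set σ := Equiv.swap a b
  have hσσ : ∀ v, σ (σ v) = v := Equiv.swap_apply_self a b
  have hR : ∀ {v}, σ v ∈ R ↔ v ∈ R := by
    intro v
    simp only [mem_sdiff] at ha hb
    by_cases hva : v = a
    · simp [σ, hva, ha.1, hb.1]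
    by_cases hvb : v = b
    · simp [σ, hvb, ha.1, hb.1]
    rw [Equiv.swap_apply_of_ne_of_ne hva hvb]
  have hS : ∀ {v}, σ v ∈ S ↔ v ∈ S := by
    intro v
    simp only [mem_sdiff] at ha hb
    by_cases hva : v = a
    · simp [σ, hva, ha.2, hb.2]
    by_cases hvb : v = b
    · simp [σ, hvb, ha.2, hb.2]
    rw [Equiv.swap_apply_of_ne_of_ne hva hvb]
  have hiter : ∀ (p : V → V) m v, (σ ∘ p ∘ σ)^[m] v = σ (p^[m] (σ v)) := by
    intro p m
    induction m with
    | zero => simp [hσσ]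
    | succ m ih => intro v; simp [iterate_succ_apply, ih, hσσ]
  refine card_le_card_of_injOn (fun x => (σ ∘ x.1 ∘ σ, σ x.2)) ?_ ?_
  · rintro ⟨p, w⟩ hx
    simp only [mem_coe, mem_treePairs, mem_parentMapsAvoiding] at hx ⊢
    obtain ⟨⟨⟨hfix, hreach⟩, havoid⟩, hw, m, hm⟩ := hx
    refine ⟨⟨⟨fun r hr => ?_, fun v => ?_⟩, fun v hv => ?_⟩, by rwa [hS], m, ?_⟩
    · simp [hfix _ (hR.2 hr), hσσ]
    · obtain ⟨m, hm⟩ := hreach (σ v)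
      exact ⟨m, by rwa [hiter, hR]⟩
    · simpa [hS] using havoid _ (mt hR.1 hv)
    · rw [hiter, hσσ, hm]
      simp [σ]
  · rintro ⟨p, w⟩ - ⟨q, z⟩ - h
    simp only [Prod.mk.injEq, EmbeddingLike.apply_eq_iff_eq] at h
    refine Prod.ext (funext fun v => ?_) h.2
    have := congrFun h.1 (σ v)
    simpa [hσσ] using this

theorem card_sdiff_mul_card_treePairs {R S : Finset V} {a : V} (ha : a ∈ R \ S) :
    (R \ S).card * (treePairs R S a).card = (parentMapsAvoiding R S).card * Sᶜ.card := by
  classical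
  have hcover : (R \ S).biUnion (treePairs R S) = parentMapsAvoiding R S ×ˢ Sᶜ := by
    ext ⟨p, w⟩
    simp only [mem_biUnion, mem_treePairs, mem_product, mem_compl]
    constructor
    · rintro ⟨b, -, hp, hw, -⟩
      exact ⟨hp, hw⟩
    · rintro ⟨hp, hw⟩
      obtain ⟨m, hm⟩ := (mem_parentMapsAvoiding.1 hp).1.2 w
      exact ⟨p^[m] w, mem_sdiff.2 ⟨hm, iterate_notMem hp hw m⟩, hp, hw, m, rfl⟩
  rw [← card_product (parentMapsAvoiding R S), ← hcover, card_biUnion, sum_const_nat]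
  · exact fun b hb => (card_treePairs_le hb ha).antisymm (card_treePairs_le ha hb)
  · intro b hb c hc hbc
    rw [Function.onFun, disjoint_left]
    intro x hxb hxc
    rw [mem_treePairs] at hxb hxc
    obtain ⟨hp, -, i, hi⟩ := hxb
    obtain ⟨-, -, j, hj⟩ := hxc
    exact hbc ((mem_parentMapsAvoiding.1 hp).1.iterate_unique (mem_sdiff.1 hb).1
      (mem_sdiff.1 hc).1 hi hj)

theorem card_parentMapsAvoiding_mul {R S : Finset V} (hS : S ⊆ R) :
    (parentMapsAvoiding R S).card * Sᶜ.card = (R \ S).card * Sᶜ.card ^ Rᶜ.card := by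
  induction hN : Rᶜ.card generalizing R with
  | zero =>
    have hR : R = univ := by simpa using hN
    subst hR
    have : parentMapsAvoiding univ S = {id} := by
      ext p
      simp only [mem_parentMapsAvoiding, mem_univ, not_true_eq_false, false_imp_iff, implies_true,
        and_true, mem_singleton, IsParentMap, forall_true_left, exists_const, funext_iff, id]
    rw [this, card_singleton, compl_eq_univ_sdiff, pow_zero, one_mul, mul_one]
  | succ N ih =>
    obtain ⟨u, hu⟩ : Rᶜ.Nonempty := card_pos.1 (by omega)
    rw [mem_compl] at hu
    have huS : u ∉ S := fun h => hu (hS h)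
    have hN' : (insert u R)ᶜ.card = N := by
      rw [card_compl, card_insert_of_notMem hu]
      rw [card_compl] at hN
      omega
    have h1 := ih (hS.trans (subset_insert u R)) hN'
    have h2 := card_parentMapsAvoiding_add (S := S) hu
    have h3 := card_sdiff_mul_card_treePairs (R := insert u R) (S := S) (a := u)
      (by simp [huS])
    have h4 : (insert u R \ S).card = (R \ S).card + 1 := by
      rw [insert_sdiff_of_notMem _ huS, card_insert_of_notMem (by simp [hu])]
    rw [h4] at h1 h3
    generalize (parentMapsAvoiding R S).card = c at *
    generalize (parentMapsAvoiding (insert u R) S).card = c' at *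
    generalize (treePairs (insert u R) S u).card = t at *
    generalize (R \ S).card = k at *
    generalize Sᶜ.card = m at *
    have h5 : (k + 1) * c = k * (c' * m) := by
      have : (k + 1) * c + (k + 1) * t = (k + 1) * (c' * m) := by rw [← h2]; ring
      rw [h3] at this
      nlinarith
    have h6 : (k + 1) * (c * m) = (k + 1) * (k * m ^ (N + 1)) := by
      calc (k + 1) * (c * m) = k * (c' * m) * m := by rw [← h5]; ring
        _ = (k + 1) * (k * m ^ (N + 1)) := by rw [h1]; ring
    exact Nat.eq_of_mul_eq_mul_left k.succ_pos h6

end Counting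

section Isolated

open Function Finset

theorem fwdDiff_iter_succ_apply (f : ℝ → ℝ) (s : ℕ) (x : ℝ) :
    (fwdDiff 1)^[s + 1] f x = (fwdDiff 1)^[s] f (x + 1) - (fwdDiff 1)^[s] f x := by
  rw [iterate_succ_apply', fwdDiff]

theorem fwdDiff_iter_succ_id_mul (g : ℝ → ℝ) (s : ℕ) (x : ℝ) :
    (fwdDiff 1)^[s + 1] (fun y => y * g y) x =
      x * (fwdDiff 1)^[s + 1] g x + (s + 1) * (fwdDiff 1)^[s] g (x + 1) := by
  induction s generalizing x with
  | zero =>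
    simp only [zero_add, iterate_one, iterate_zero, id, fwdDiff, Nat.cast_zero]
    ring
  | succ s ih =>
    rw [fwdDiff_iter_succ_apply _ (s + 1), ih, ih, fwdDiff_iter_succ_apply g (s + 1),
      fwdDiff_iter_succ_apply g s (x + 1)]
    push_cast
    ring

variable {V : Type*} [Fintype V] [DecidableEq V]

open Classical in
/-- The parent maps avoiding `S` for which every vertex of `A` is the image of a vertex
outside `R`. -/
noncomputable def parentMapsHitting (R S A : Finset V) : Finset (V → V) :=
  (parentMapsAvoiding R S).filter fun p => ∀ a ∈ A, ∃ w ∉ R, p w = a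

theorem mem_parentMapsHitting {R S A : Finset V} {p : V → V} :
    p ∈ parentMapsHitting R S A ↔
      p ∈ parentMapsAvoiding R S ∧ ∀ a ∈ A, ∃ w ∉ R, p w = a := by
  simp [parentMapsHitting]

theorem card_parentMapsHitting_insert (R S A : Finset V) (a : V) :
    (parentMapsHitting R S (insert a A)).card + (parentMapsHitting R (insert a S) A).card =
      (parentMapsHitting R S A).card := by
  classical
  rw [← card_filter_add_card_filter_not (s := parentMapsHitting R S A)
    (fun p : V → V => ∃ w ∉ R, p w = a)]
  congr 2
  · ext p
    simp only [mem_parentMapsHitting, mem_filter, forall_mem_insert]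
    tauto
  · ext p
    simp only [mem_parentMapsHitting, mem_parentMapsAvoiding, mem_filter, mem_insert, not_or,
      not_exists, not_and]
    constructor
    · rintro ⟨⟨hp, hS⟩, hA⟩
      exact ⟨⟨⟨hp, fun v hv => (hS v hv).2⟩, hA⟩, fun v hv => (hS v hv).1⟩
    · rintro ⟨⟨⟨hp, hS⟩, hA⟩, ha⟩
      exact ⟨⟨hp, fun v hv => ⟨ha v hv, hS v hv⟩⟩, hA⟩

theorem card_parentMapsHitting {R S A : Finset V} {T : ℕ} (hT : Rᶜ.card = T + 1) (hS : S ⊆ R)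
    (hA : A ⊆ R \ S) :
    ((parentMapsHitting R S A).card : ℝ) =
      (fwdDiff 1)^[A.card] (fun x : ℝ => x * (x + (T + 1)) ^ T) ((R \ S).card - A.card) := by
  induction A using Finset.induction_on generalizing S with
  | empty =>
    have h := card_parentMapsAvoiding_mul hS
    have hc : Sᶜ.card = (R \ S).card + (T + 1) := by
      rw [← hT, card_compl, card_compl, card_sdiff_of_subset hS]
      have := card_le_card hS
      have := card_le_univ R
      omega
    have h0 : parentMapsHitting R S ∅ = parentMapsAvoiding R S := by
      simp [parentMapsHitting]
    rw [hT, hc, pow_succ, ← mul_assoc] at h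
    have h' := Nat.eq_of_mul_eq_mul_right (by omega) h
    rw [h0, h']
    simp
  | insert a A ha ih =>
    have haRS := hA (mem_insert_self a A)
    rw [mem_sdiff] at haRS
    have hAS : A ⊆ R \ insert a S := by
      intro b hb
      have := mem_sdiff.1 (hA (mem_insert_of_mem hb))
      simp only [mem_sdiff, mem_insert, not_or]
      exact ⟨this.1, ne_of_mem_of_not_mem hb ha, this.2⟩
    have h1 := ih hS ((subset_insert a A).trans hA)
    have h2 := ih (insert_subset haRS.1 hS) hAS
    have h3 : ((R \ S).card : ℝ) = (R \ insert a S).card + 1 := by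
      rw [sdiff_insert, ← Nat.cast_succ, Nat.succ_eq_add_one,
        card_erase_add_one (mem_sdiff.2 haRS)]
    have h4 : ((parentMapsHitting R S (insert a A)).card : ℝ) +
        (parentMapsHitting R (insert a S) A).card = (parentMapsHitting R S A).card := by
      exact_mod_cast card_parentMapsHitting_insert R S A a
    rw [eq_sub_of_add_eq h4, h1, h2, card_insert_of_notMem ha, fwdDiff_iter_succ_apply, h3,
      show ((R \ insert a S).card + 1 - (A.card + 1 : ℕ) : ℝ) = (R \ insert a S).card - A.card by
        push_cast; ring,
      add_sub_right_comm]

open Classical in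
/-- The roots which are not the image of a vertex outside `R`. -/
noncomputable def unusedRoots (R : Finset V) (p : V → V) : Finset V :=
  R.filter fun r => ∀ w ∉ R, p w ≠ r

theorem unusedRoots_eq_iff {R S : Finset V} (hS : S ⊆ R) {p : V → V} :
    IsParentMap R p ∧ unusedRoots R p = S ↔ p ∈ parentMapsHitting R S (R \ S) := by
  simp only [mem_parentMapsHitting, mem_parentMapsAvoiding, mem_sdiff, unusedRoots,
    Finset.ext_iff, mem_filter]
  constructor
  · rintro ⟨hp, h⟩
    refine ⟨⟨hp, fun v hv hpv => ((h _).2 hpv).2 v hv rfl⟩, fun a ha => ?_⟩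
    by_contra! hcon
    exact ha.2 ((h a).1 ⟨ha.1, hcon⟩)
  · rintro ⟨⟨hp, hav⟩, hhit⟩
    refine ⟨hp, fun a => ⟨fun ha => ?_, fun ha => ⟨hS ha, fun w hw hwa => hav w hw (hwa ▸ ha)⟩⟩⟩
    by_contra haS
    obtain ⟨w, hw, hwa⟩ := hhit a ⟨ha.1, haS⟩
    exact ha.2 w hw hwa

open Classical in
theorem card_unusedRoots_eq {R : Finset V} {T K ℓ : ℕ} (hT : Rᶜ.card = T + 1)
    (hR : R.card = K + 1) (hℓ : ℓ ≤ K) :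
    ((univ.filter fun p => IsParentMap R p ∧ (unusedRoots R p).card = ℓ).card : ℝ) =
      (K + 1) * K.choose ℓ *
        (fwdDiff 1)^[K - ℓ] (fun x : ℝ => (x + (T + 1)) ^ T) 1 := by
  have h : (univ.filter fun p => IsParentMap R p ∧ (unusedRoots R p).card = ℓ) =
      (R.powersetCard ℓ).biUnion fun S => parentMapsHitting R S (R \ S) := by
    ext p
    simp only [mem_filter, mem_univ, true_and, mem_biUnion, mem_powersetCard]
    constructor
    · rintro ⟨hp, hc⟩
      have hsub : unusedRoots R p ⊆ R := filter_subset _ _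
      exact ⟨_, ⟨hsub, hc⟩, (unusedRoots_eq_iff hsub).1 ⟨hp, rfl⟩⟩
    · rintro ⟨S, ⟨hS, hc⟩, hp⟩
      obtain ⟨hp', rfl⟩ := (unusedRoots_eq_iff hS).2 hp
      exact ⟨hp', hc⟩
  have hdisj : ((R.powersetCard ℓ : Finset (Finset V)) : Set (Finset V)).PairwiseDisjoint
      fun S => parentMapsHitting R S (R \ S) := by
    intro S hS S' hS' hne
    rw [Function.onFun, disjoint_left]
    intro p hp hp'
    rw [← unusedRoots_eq_iff (mem_powersetCard.1 hS).1] at hp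
    rw [← unusedRoots_eq_iff (mem_powersetCard.1 hS').1] at hp'
    exact hne (hp.2.symm.trans hp'.2)
  rw [h, card_biUnion hdisj, Nat.cast_sum]
  have hterm : ∀ S ∈ R.powersetCard ℓ, ((parentMapsHitting R S (R \ S)).card : ℝ) =
      ((K - ℓ : ℕ) + 1) * (fwdDiff 1)^[K - ℓ] (fun x : ℝ => (x + (T + 1)) ^ T) 1 := by
    intro S hS
    obtain ⟨hS, hc⟩ := mem_powersetCard.1 hS
    have hcard : (R \ S).card = K - ℓ + 1 := by
      rw [card_sdiff_of_subset hS]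
      omega
    rw [card_parentMapsHitting hT hS subset_rfl, sub_self, hcard,
      fwdDiff_iter_succ_id_mul (fun x : ℝ => (x + (T + 1)) ^ T)]
    simp
  rw [sum_congr rfl hterm, sum_const, card_powersetCard, hR, nsmul_eq_mul, ← mul_assoc]
  congr 1
  have := Nat.choose_mul_succ_eq K ℓ
  rw [show K + 1 - ℓ = K - ℓ + 1 by omega] at this
  rw [mul_comm ((K : ℝ) + 1)]
  exact_mod_cast this.symm

theorem card_isParentMap {R : Finset V} {T : ℕ} (hT : Rᶜ.card = T + 1) [DecidablePred (IsParentMap R)] :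
    (univ.filter (IsParentMap R)).card = R.card * Fintype.card V ^ T := by
  have h := card_parentMapsAvoiding_mul (empty_subset R)
  have h0 : parentMapsAvoiding R ∅ = univ.filter (IsParentMap R) := by
    ext p
    simp [mem_parentMapsAvoiding]
  rw [h0, hT, compl_empty, card_univ, sdiff_empty, pow_succ, ← mul_assoc] at h
  refine Nat.eq_of_mul_eq_mul_right ?_ h
  have := card_le_univ Rᶜ
  omega

end Isolated

section Probability

open Finset FODef

/-- The first `k` of `n` vertices. -/
def rootSet (n k : ℕ) : Finset (Fin n) :=
  univ.filter fun v => v.val < k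

theorem isRootedForest_iff {n k : ℕ} {F : SimpleGraph (Fin n)} :
    IsRootedForest n k F ↔ IsForestRootedAt (rootSet n k) F := by
  simp [IsRootedForest, IsForestRootedAt, rootSet]

open Classical in
theorem card_rootedForest_eq (n k : ℕ) (E : Set (SimpleGraph (Fin n))) :
    (univ.filter fun F => IsRootedForest n k F ∧ F ∈ E).card =
      (univ.filter fun p => IsParentMap (rootSet n k) p ∧ parentGraph p ∈ E).card := by
  symm
  refine card_bij (fun p _ => parentGraph p) ?_ ?_ ?_
  · intro p hp
    simp only [mem_filter, mem_univ, true_and, isRootedForest_iff] at hp ⊢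
    exact ⟨hp.1.isForestRootedAt, hp.2⟩
  · intro p hp q hq h
    simp only [mem_filter, mem_univ, true_and] at hp hq
    exact hp.1.eq_of_parentGraph_eq hq.1 h
  · intro F hF
    simp only [mem_filter, mem_univ, true_and, isRootedForest_iff] at hF
    obtain ⟨p, hp, rfl⟩ := hF.1.exists_parentMap
    exact ⟨p, by simpa using ⟨hp, hF.2⟩, rfl⟩

open Classical in
theorem rfProb_eq (n k : ℕ) (E : Set (SimpleGraph (Fin n))) :
    rfProb n k E =
      ((univ.filter fun p => IsParentMap (rootSet n k) p ∧ parentGraph p ∈ E).card : ℝ) /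
        (univ.filter (IsParentMap (rootSet n k))).card := by
  have h := card_rootedForest_eq n k Set.univ
  simp only [Set.mem_univ, and_true] at h
  rw [rfProb, card_rootedForest_eq]
  congr 2

theorem isolCount_parentGraph {n : ℕ} {R : Finset (Fin n)} {p : Fin n → Fin n}
    (hp : IsParentMap R p) : isolCount (parentGraph p) = (unusedRoots R p).card := by
  classical
  rw [isolCount, Nat.card_eq_fintype_card, Fintype.card_subtype]
  congr 1
  ext v
  simp [hp.isolated_iff, unusedRoots]

theorem rfProb_isolCount {K T ℓ : ℕ} (hℓ : ℓ ≤ K) :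
    rfProb (K + T + 2) (K + 1) {F | isolCount F = ℓ} =
      K.choose ℓ * ((fwdDiff 1)^[K - ℓ] (fun x : ℝ => (x + (T + 1)) ^ T) 1 /
        ((K + T + 2 : ℕ) : ℝ) ^ T) := by
  classical
  set n := K + T + 2
  set R := rootSet n (K + 1)
  have hR : R.card = K + 1 := by
    simp only [R, rootSet]
    rw [Fin.card_filter_val_lt]
    omega
  have hT : Rᶜ.card = T + 1 := by
    rw [card_compl, hR, Fintype.card_fin]
    omega
  have h : rfProb n (K + 1) {F | isolCount F = ℓ} =
      (K + 1) * K.choose ℓ * (fwdDiff 1)^[K - ℓ] (fun x : ℝ => (x + (T + 1)) ^ T) 1 /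
        (((K + 1) * n ^ T : ℕ) : ℝ) := by
    rw [rfProb_eq, ← card_unusedRoots_eq hT hR hℓ, card_isParentMap hT, hR, Fintype.card_fin]
    congr 3
    ext p
    simp only [mem_filter, mem_univ, true_and, Set.mem_ofPred_eq]
    exact and_congr_right fun hp => by rw [isolCount_parentGraph hp]
  rw [h]
  push_cast
  have hn : (n : ℝ) ≠ 0 := by positivity
  have hK : (K : ℝ) + 1 ≠ 0 := by positivity
  field_simp

end Probability

section Estimates

open Function

theorem fwdDiff_iter_nonneg {f : ℝ → ℝ} {s : ℕ} {x : ℝ} (hf : ContDiff ℝ s f)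
    (h : ∀ y ∈ Set.Icc x (x + s), 0 ≤ iteratedDeriv s f y) : 0 ≤ (fwdDiff 1)^[s] f x := by
  induction s generalizing f with
  | zero => simpa using h x (by simp)
  | succ s ih =>
    have hf' : ContDiff ℝ s f := hf.of_le (by exact_mod_cast s.le_succ)
    have hshift : ContDiff ℝ s fun y => f (y + 1) := hf'.comp (contDiff_id.add contDiff_const)
    have hdiff : Differentiable ℝ (iteratedDeriv s f) :=
      hf.differentiable_iteratedDeriv s (by exact_mod_cast s.lt_succ_self)
    have hmono : MonotoneOn (iteratedDeriv s f) (Set.Icc x (x + (s + 1 : ℕ))) := by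
      refine monotoneOn_of_deriv_nonneg (convex_Icc _ _) hdiff.continuous.continuousOn
        hdiff.differentiableOn fun y hy => ?_
      rw [← iteratedDeriv_succ]
      exact h y (interior_subset hy)
    rw [iterate_succ_apply]
    refine ih (hshift.sub hf') fun y hy => ?_
    change 0 ≤ iteratedDeriv s (fun z => f (z + 1) - f z) y
    rw [iteratedDeriv_fun_sub hshift.contDiffAt hf'.contDiffAt, iteratedDeriv_comp_add_const,
      sub_nonneg]
    obtain ⟨h1, h2⟩ := hy
    push_cast at hmono
    exact hmono ⟨h1, by linarith⟩ ⟨by linarith, by linarith⟩ (by linarith)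

theorem fwdDiff_iter_le_of_iteratedDeriv_le {f g : ℝ → ℝ} {s : ℕ} {x : ℝ} (hf : ContDiff ℝ s f)
    (hg : ContDiff ℝ s g)
    (h : ∀ y ∈ Set.Icc x (x + s), iteratedDeriv s f y ≤ iteratedDeriv s g y) :
    (fwdDiff 1)^[s] f x ≤ (fwdDiff 1)^[s] g x := by
  have hsub : (fwdDiff 1)^[s] (fun y => g y - f y) x =
      (fwdDiff 1)^[s] g x - (fwdDiff 1)^[s] f x := by
    clear h hf hg
    induction s generalizing x with
    | zero => rfl
    | succ s ih => simp only [fwdDiff_iter_succ_apply, ih]; ring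
  rw [← sub_nonneg, ← hsub]
  refine fwdDiff_iter_nonneg (hg.sub hf) fun y hy => ?_
  rw [iteratedDeriv_fun_sub hg.contDiffAt hf.contDiffAt, sub_nonneg]
  exact h y hy

theorem fwdDiff_iter_const_mul_exp (c : ℝ) (s : ℕ) (x : ℝ) :
    (fwdDiff 1)^[s] (fun y => c * Real.exp y) x =
      c * Real.exp x * (Real.exp 1 - 1) ^ s := by
  induction s generalizing x with
  | zero => simp
  | succ s ih => rw [fwdDiff_iter_succ_apply, ih, ih, Real.exp_add]; ring

theorem iteratedDeriv_const_mul_exp (c : ℝ) (s : ℕ) (x : ℝ) :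
    iteratedDeriv s (fun y => c * Real.exp y) x = c * Real.exp x := by
  rw [iteratedDeriv_const_mul_field, iteratedDeriv_eq_iterate, Real.iter_deriv_exp]

theorem iteratedDeriv_add_pow (a : ℝ) (T s : ℕ) (x : ℝ) :
    iteratedDeriv s (fun y => (y + a) ^ T) x = T.descFactorial s * (x + a) ^ (T - s) := by
  rw [iteratedDeriv_comp_add_const s (fun z : ℝ => z ^ T) a]
  exact iteratedDeriv_pow T s

theorem exp_neg_mul_le_one_sub_pow {t : ℝ} (ht0 : 0 ≤ t) (ht1 : t ≤ 1) (n : ℕ) :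
    Real.exp (-(n * t)) * (1 - n * t ^ 2) ≤ (1 - t) ^ n := by
  have h1 : Real.exp (-t) * (1 - t ^ 2) ≤ 1 - t := by
    have h2 : Real.exp (-t) * (1 + t) ≤ 1 := by
      rw [Real.exp_neg, inv_mul_le_iff₀ (Real.exp_pos t), mul_one]
      linarith [Real.add_one_le_exp t]
    nlinarith
  have h3 : 1 - n * t ^ 2 ≤ (1 - t ^ 2) ^ n := by
    have := one_add_mul_le_pow (a := -t ^ 2) (by nlinarith) n
    simpa [sub_eq_add_neg] using this
  calc Real.exp (-(n * t)) * (1 - n * t ^ 2) ≤ Real.exp (-(n * t)) * (1 - t ^ 2) ^ n := by gcongr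
    _ = (Real.exp (-t) * (1 - t ^ 2)) ^ n := by
      rw [mul_pow, ← Real.exp_nat_mul, mul_neg]
    _ ≤ (1 - t) ^ n := by
      gcongr
      exact mul_nonneg (Real.exp_pos _).le (by nlinarith)

variable {K T r : ℕ}

theorem descFactorial_mul_one_sub_pow_le (hr : r ≤ K)
    (hn : 4 * (K + 1) ^ 2 ≤ K + T + 2) {t : ℝ} (ht0 : 0 ≤ t) (ht : t * (K + T + 2) ≤ K) :
    T.descFactorial r / ((K : ℝ) + T + 2) ^ r * (1 - t) ^ (T - r) ≤
      (1 + 4 * ((K + 1) ^ 2 / ((K : ℝ) + T + 2))) * Real.exp (-((K + T + 2) * t)) := by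
  have hrT : r ≤ T := by nlinarith
  have hn' : 4 * ((K : ℝ) + 1) ^ 2 ≤ K + T + 2 := by exact_mod_cast hn
  have hr' : (r : ℝ) ≤ K := by exact_mod_cast hr
  have hK : (0 : ℝ) ≤ K := K.cast_nonneg
  have hT : (0 : ℝ) ≤ T := T.cast_nonneg
  have hpos : (0 : ℝ) < K + T + 2 := by positivity
  set a : ℝ := (K + 1) ^ 2 / ((K : ℝ) + T + 2) with ha
  have ha0 : 0 ≤ a := by positivity
  have ha1 : a ≤ 1 / 4 := by rw [ha, div_le_iff₀ hpos]; linarith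
  have ht1 : t ≤ 1 := by nlinarith
  have h1 : T.descFactorial r / ((K : ℝ) + T + 2) ^ r ≤ 1 := by
    rw [div_le_one (by positivity)]
    calc (T.descFactorial r : ℝ) ≤ (T : ℝ) ^ r := by exact_mod_cast T.descFactorial_le_pow r
      _ ≤ _ := by gcongr; linarith
  have ht2 : t * (K + 1) ≤ a := by
    rw [ha, le_div_iff₀ hpos]
    nlinarith
  have h2 : (1 - t) ^ (T - r) ≤ Real.exp (2 * a) * Real.exp (-((K + T + 2) * t)) := by
    calc (1 - t) ^ (T - r) ≤ Real.exp (-t) ^ (T - r) := by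
          gcongr
          exact Real.one_sub_le_exp_neg t
      _ = Real.exp (-(((T : ℝ) - r) * t)) := by
          rw [← Real.exp_nat_mul, Nat.cast_sub hrT, mul_neg]
      _ ≤ Real.exp (2 * a + -((K + T + 2) * t)) := by
          apply Real.exp_le_exp.2
          nlinarith
      _ = _ := Real.exp_add _ _
  have h3 : Real.exp (2 * a) ≤ 1 + 4 * a := by
    refine (Real.exp_bound_div_one_sub_of_interval (by positivity) (by linarith)).trans ?_
    rw [div_le_iff₀ (by linarith)]
    nlinarith
  have h4 : 0 ≤ (1 - t) ^ (T - r) := pow_nonneg (by linarith) _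
  calc _ ≤ 1 * (1 - t) ^ (T - r) := by gcongr
    _ ≤ Real.exp (2 * a) * Real.exp (-((K + T + 2) * t)) := by rwa [one_mul]
    _ ≤ _ := by gcongr

theorem le_descFactorial_mul_one_sub_pow (hr : r ≤ K)
    (hn : 4 * (K + 1) ^ 2 ≤ K + T + 2) {t : ℝ} (ht0 : 0 ≤ t) (ht : t * (K + T + 2) ≤ K) :
    (1 - 4 * ((K + 1) ^ 2 / ((K : ℝ) + T + 2))) * Real.exp (-((K + T + 2) * t)) ≤
      T.descFactorial r / ((K : ℝ) + T + 2) ^ r * (1 - t) ^ (T - r) := by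
  have hrT : r ≤ T := by nlinarith
  have hn' : 4 * ((K : ℝ) + 1) ^ 2 ≤ K + T + 2 := by exact_mod_cast hn
  have hr' : (r : ℝ) ≤ K := by exact_mod_cast hr
  have hK : (0 : ℝ) ≤ K := K.cast_nonneg
  have hT : (0 : ℝ) ≤ T := T.cast_nonneg
  have hpos : (0 : ℝ) < K + T + 2 := by positivity
  set a : ℝ := (K + 1) ^ 2 / ((K : ℝ) + T + 2) with ha
  have ha0 : 0 ≤ a := by positivity
  have ha1 : a ≤ 1 / 4 := by rw [ha, div_le_iff₀ hpos]; linarith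
  have ht1 : t ≤ 1 := by nlinarith
  have ht2 : (K + T + 2) * t ^ 2 ≤ a := by
    rw [ha, le_div_iff₀ hpos]
    calc (K + T + 2) * t ^ 2 * ((K : ℝ) + T + 2) = (t * (K + T + 2)) ^ 2 := by ring
      _ ≤ (K : ℝ) ^ 2 := by gcongr
      _ ≤ _ := by nlinarith
  have h1 : 1 - 2 * a ≤ T.descFactorial r / ((K : ℝ) + T + 2) ^ r := by
    have hd : ((T : ℝ) + 1 - r) ^ r ≤ T.descFactorial r := by
      have := T.pow_sub_le_descFactorial r
      rw [← Nat.cast_le (α := ℝ)] at this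
      push_cast [show r ≤ T + 1 by omega] at this
      exact this
    rw [le_div_iff₀ (by positivity)]
    refine le_trans ?_ hd
    have hb := one_add_mul_le_pow (a := -((K + 1 + r) / ((K : ℝ) + T + 2)))
      (by rw [neg_le_neg_iff, div_le_iff₀ hpos]; nlinarith) r
    have he : (T : ℝ) + 1 - r = (1 + -((K + 1 + r) / ((K : ℝ) + T + 2))) * (K + T + 2) := by
      field_simp
      ring
    rw [he, mul_pow]
    refine mul_le_mul_of_nonneg_right (le_trans ?_ hb) (by positivity)
    have hc : r * ((K + 1 + r) / ((K : ℝ) + T + 2)) ≤ 2 * a := by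
      rw [ha, ← mul_div_assoc, ← mul_div_assoc, div_le_div_iff_of_pos_right hpos]
      nlinarith
    linarith
  have h2 : Real.exp (-((K + T + 2) * t)) * (1 - a) ≤ (1 - t) ^ (T - r) := by
    have hb := exp_neg_mul_le_one_sub_pow ht0 ht1 (K + T + 2)
    push_cast at hb
    calc _ ≤ Real.exp (-((K + T + 2) * t)) * (1 - (K + T + 2) * t ^ 2) := by gcongr
      _ ≤ (1 - t) ^ (K + T + 2) := hb
      _ ≤ (1 - t) ^ (T - r) :=
        pow_le_pow_of_le_one (by linarith) (by linarith) (by omega)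
  have hexp := Real.exp_pos (-(((K : ℝ) + T + 2) * t))
  calc _ ≤ (1 - 2 * a) * (Real.exp (-((K + T + 2) * t)) * (1 - a)) := by nlinarith [mul_nonneg hexp.le ha0]
    _ ≤ _ := mul_le_mul h1 h2 (mul_nonneg hexp.le (by linarith)) (le_trans (by linarith) h1)

theorem descFactorial_mul_add_pow_div (hrT : r ≤ T) (y : ℝ) :
    T.descFactorial r * (y + (T + 1)) ^ (T - r) =
      ((K : ℝ) + T + 2) ^ T * (T.descFactorial r / ((K : ℝ) + T + 2) ^ r *
        (1 - (K + 1 - y) / ((K : ℝ) + T + 2)) ^ (T - r)) := by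
  have hpos : (0 : ℝ) < K + T + 2 := by positivity
  have h1 : y + (T + 1) = (1 - (K + 1 - y) / ((K : ℝ) + T + 2)) * (K + T + 2) := by
    field_simp
    ring
  have h2 : ((K : ℝ) + T + 2) ^ T = ((K : ℝ) + T + 2) ^ (T - r) * ((K : ℝ) + T + 2) ^ r := by
    rw [← pow_add, Nat.sub_add_cancel hrT]
  rw [h2, h1, mul_pow]
  field_simp

theorem abs_fwdDiff_iter_add_pow_div_sub_one_le (hr : r ≤ K)
    (hn : 4 * (K + 1) ^ 2 ≤ K + T + 2) :
    |(fwdDiff 1)^[r] (fun x : ℝ => (x + (T + 1)) ^ T) 1 / ((K : ℝ) + T + 2) ^ T /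
      (Real.exp (-(K : ℝ)) * (Real.exp 1 - 1) ^ r) - 1| ≤
        4 * ((K + 1) ^ 2 / ((K : ℝ) + T + 2)) := by
  have hrT : r ≤ T := by nlinarith
  have hr' : (r : ℝ) ≤ K := by exact_mod_cast hr
  have hpos : (0 : ℝ) < K + T + 2 := by positivity
  set a : ℝ := (K + 1) ^ 2 / ((K : ℝ) + T + 2)
  set n : ℝ := (K : ℝ) + T + 2
  have hf : ContDiff ℝ r fun x : ℝ => (x + (T + 1)) ^ T :=
    (contDiff_id.add contDiff_const).pow T
  have hg : ∀ c : ℝ, ContDiff ℝ r fun x : ℝ => c * Real.exp x := fun c =>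
    contDiff_const.mul Real.contDiff_exp
  have ht : ∀ y ∈ Set.Icc (1 : ℝ) (1 + r), 0 ≤ (K + 1 - y) / n ∧ (K + 1 - y) / n * n ≤ K := by
    rintro y ⟨h1, h2⟩
    refine ⟨div_nonneg (by linarith) hpos.le, ?_⟩
    rw [div_mul_cancel₀ _ hpos.ne']
    linarith
  have hexp : ∀ y : ℝ, Real.exp (-(n * ((K + 1 - y) / n))) =
      Real.exp (-(K + 1)) * Real.exp y := by
    intro y
    rw [mul_div_cancel₀ _ hpos.ne', ← Real.exp_add]
    ring_nf
  have hE : ∀ c, (fwdDiff 1)^[r] (fun y => n ^ T * (c * Real.exp (-(K + 1))) * Real.exp y) 1 =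
      c * (n ^ T * (Real.exp (-(K : ℝ)) * (Real.exp 1 - 1) ^ r)) := by
    intro c
    have : Real.exp (-(K : ℝ)) = Real.exp (-(K + 1)) * Real.exp 1 := by
      rw [← Real.exp_add]
      ring_nf
    rw [fwdDiff_iter_const_mul_exp, this]
    ring
  have hup : (fwdDiff 1)^[r] (fun x : ℝ => (x + (T + 1)) ^ T) 1 ≤
      (1 + 4 * a) * (n ^ T * (Real.exp (-(K : ℝ)) * (Real.exp 1 - 1) ^ r)) := by
    rw [← hE]
    refine fwdDiff_iter_le_of_iteratedDeriv_le hf (hg _) fun y hy => ?_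
    rw [iteratedDeriv_add_pow, iteratedDeriv_const_mul_exp, descFactorial_mul_add_pow_div hrT,
      mul_assoc (n ^ T), mul_assoc, ← hexp]
    refine mul_le_mul_of_nonneg_left ?_ (by positivity)
    exact descFactorial_mul_one_sub_pow_le hr hn (ht y hy).1 (ht y hy).2
  have hlow : (1 - 4 * a) * (n ^ T * (Real.exp (-(K : ℝ)) * (Real.exp 1 - 1) ^ r)) ≤
      (fwdDiff 1)^[r] (fun x : ℝ => (x + (T + 1)) ^ T) 1 := by
    rw [← hE]
    refine fwdDiff_iter_le_of_iteratedDeriv_le (hg _) hf fun y hy => ?_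
    rw [iteratedDeriv_add_pow, iteratedDeriv_const_mul_exp, descFactorial_mul_add_pow_div hrT,
      mul_assoc (n ^ T), mul_assoc, ← hexp]
    refine mul_le_mul_of_nonneg_left ?_ (by positivity)
    exact le_descFactorial_mul_one_sub_pow hr hn (ht y hy).1 (ht y hy).2
  have he : 0 < Real.exp 1 - 1 := by linarith [Real.add_one_lt_exp one_ne_zero]
  have hden : 0 < n ^ T * (Real.exp (-(K : ℝ)) * (Real.exp 1 - 1) ^ r) := by positivity
  rw [div_div, abs_sub_le_iff, sub_le_iff_le_add, div_le_iff₀ hden, sub_le_comm,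
    le_div_iff₀ hden]
  exact ⟨by linarith, hlow⟩

end Estimates

section Main

open FODef

theorem exp_neg_mul_exp_one_sub_one_pow {K ℓ : ℕ} (hℓ : ℓ ≤ K) :
    Real.exp (-(K : ℝ)) * (Real.exp 1 - 1) ^ (K - ℓ) =
      Real.exp (-(ℓ : ℝ)) * (1 - Real.exp (-1)) ^ (K - ℓ) := by
  have h1 : 1 - Real.exp (-1) = Real.exp (-1) * (Real.exp 1 - 1) := by
    rw [mul_sub, ← Real.exp_add]
    simp
  have h2 : Real.exp (-(K : ℝ)) = Real.exp (-(ℓ : ℝ)) * Real.exp (-1) ^ (K - ℓ) := by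
    rw [← Real.exp_nat_mul, ← Real.exp_add, Nat.cast_sub hℓ]
    ring_nf
  rw [h1, mul_pow, h2]
  ring

/-- The relative error of the binomial approximation to the distribution of the number of
isolated vertices. -/
noncomputable def relativeError (n k ℓ : ℕ) : ℝ :=
  rfProb n k {F | isolCount F = ℓ} /
    (((k - 1).choose ℓ : ℝ) * Real.exp (-(ℓ : ℝ)) * (1 - Real.exp (-1)) ^ (k - ℓ - 1)) - 1

theorem rfProb_eq_relativeError {n k ℓ : ℕ} (hℓ : ℓ ≤ k - 1) :
    rfProb n k {F | isolCount F = ℓ} =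
      (1 + relativeError n k ℓ) * ((k - 1).choose ℓ : ℝ) * Real.exp (-(ℓ : ℝ)) *
        (1 - Real.exp (-1)) ^ (k - ℓ - 1) := by
  have h1 : (0 : ℝ) < (k - 1).choose ℓ := by exact_mod_cast Nat.choose_pos hℓ
  have h2 : 0 < 1 - Real.exp (-1) := by
    rw [sub_pos, Real.exp_lt_one_iff]
    norm_num
  have h3 : ((k - 1).choose ℓ : ℝ) * Real.exp (-(ℓ : ℝ)) *
      (1 - Real.exp (-1)) ^ (k - ℓ - 1) ≠ 0 := by positivity
  rw [relativeError, add_sub_cancel, mul_assoc, mul_assoc, ← mul_assoc (Nat.cast _),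
    div_mul_cancel₀ _ h3]

theorem abs_relativeError_le {n k ℓ : ℕ} (hk : 1 ≤ k) (hn : 4 * k ^ 2 ≤ n) (hℓ : ℓ ≤ k - 1) :
    |relativeError n k ℓ| ≤ 4 * ((k : ℝ) ^ 2 / n) := by
  obtain ⟨K, rfl⟩ := Nat.exists_eq_add_of_le' hk
  obtain ⟨T, rfl⟩ : ∃ T, n = K + T + 2 := ⟨n - (K + 2), by nlinarith [Nat.sub_add_cancel (show K + 2 ≤ n by nlinarith)]⟩
  rw [Nat.add_sub_cancel] at hℓ
  have hchoose : (K.choose ℓ : ℝ) ≠ 0 := by exact_mod_cast (Nat.choose_pos hℓ).ne'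
  have h := abs_fwdDiff_iter_add_pow_div_sub_one_le (Nat.sub_le K ℓ) hn
  rw [exp_neg_mul_exp_one_sub_one_pow hℓ] at h
  rw [relativeError, rfProb_isolCount hℓ, Nat.add_sub_cancel,
    show K + 1 - ℓ - 1 = K - ℓ by omega, mul_assoc, mul_div_mul_left _ _ hchoose]
  push_cast
  exact h

theorem exists_four_mul_sq_le :
    ∃ N : ℕ, ∀ n k : ℕ, N ≤ n → (k : ℝ) ≤ Real.log n ^ 4 → 4 * k ^ 2 ≤ n := by
  have h := (Real.isLittleO_pow_log_id_atTop (n := 8)).bound (show (0 : ℝ) < 1 / 4 by norm_num)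
  obtain ⟨N, hN⟩ := Filter.eventually_atTop.1
    ((tendsto_natCast_atTop_atTop (R := ℝ)).eventually h)
  refine ⟨N, fun n k hn hk => ?_⟩
  have h1 := hN n hn
  rw [Real.norm_of_nonneg (by positivity), id, Real.norm_of_nonneg n.cast_nonneg] at h1
  have h2 : (k : ℝ) ^ 2 ≤ Real.log n ^ 8 := by
    calc (k : ℝ) ^ 2 ≤ (Real.log n ^ 4) ^ 2 := by gcongr
      _ = _ := by ring
  have h3 : 4 * (k : ℝ) ^ 2 ≤ n := by linarith
  exact_mod_cast h3

theorem le_pow_of_le_log_pow {n k : ℕ} (hk : (k : ℝ) ≤ Real.log n ^ 4) : k ≤ n ^ 4 := by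
  have h : (k : ℝ) ≤ (n : ℝ) ^ 4 :=
    hk.trans (pow_le_pow_left₀ (Real.log_natCast_nonneg n) (Real.log_le_self n.cast_nonneg) 4)
  exact_mod_cast h

end Main

theorem statement16 :
    ∃ M : ℝ, ∀ n k ℓ : ℕ, 1 ≤ k → (k : ℝ) ≤ Real.log n ^ 4 → ℓ ≤ k - 1 →
      ∃ θ : ℝ, |θ| ≤ M * k ^ 2 / n ∧
        rfProb n k {F | isolCount F = ℓ} =
          (1 + θ) * ((k - 1).choose ℓ : ℝ) * Real.exp (-(ℓ : ℝ)) *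
            (1 - Real.exp (-1)) ^ (k - ℓ - 1) := by
  obtain ⟨N, hN⟩ := exists_four_mul_sq_le
  obtain ⟨B, hB⟩ := ((Finset.range N ×ˢ Finset.range (N ^ 4 + 1) ×ˢ
    Finset.range (N ^ 4 + 1)).image fun x => |relativeError x.1 x.2.1 x.2.2|).bddAbove
  refine ⟨max 4 (B * N), fun n k ℓ hk hkn hℓ =>
    ⟨relativeError n k ℓ, ?_, rfProb_eq_relativeError hℓ⟩⟩
  have hk1 : (1 : ℝ) ≤ k := by exact_mod_cast hk
  rcases le_or_gt N n with hn | hn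
  · calc |relativeError n k ℓ| ≤ 4 * ((k : ℝ) ^ 2 / n) := abs_relativeError_le hk (hN n k hn hkn) hℓ
      _ = 4 * (k : ℝ) ^ 2 / n := by ring
      _ ≤ max 4 (B * N) * k ^ 2 / n := by gcongr; exact le_max_left _ _
  · have hn0 : (0 : ℝ) < n := by
      rcases n.eq_zero_or_pos with rfl | h
      · norm_num at hkn
        omega
      · exact_mod_cast h
    have hkN : k ≤ N ^ 4 := (le_pow_of_le_log_pow hkn).trans (Nat.pow_le_pow_left hn.le 4)
    have hle : |relativeError n k ℓ| ≤ B := by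
      refine hB (Finset.mem_coe.2 (Finset.mem_image.2 ⟨(n, k, ℓ), ?_, rfl⟩))
      simp only [Finset.mem_product, Finset.mem_range]
      omega
    have hB0 : 0 ≤ B := (abs_nonneg _).trans hle
    rw [le_div_iff₀ hn0]
    calc |relativeError n k ℓ| * n ≤ B * N := by gcongr
      _ ≤ max 4 (B * N) := le_max_right _ _
      _ ≤ max 4 (B * N) * k ^ 2 :=
        le_mul_of_one_le_right (le_max_of_le_left (by norm_num)) (one_le_pow₀ hk1)
end
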